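/- arXiv:2505.07009 — 7 statements merged into one kernel-verified Lean document; each statement's English description precedes it below -/
import Mathlib

section
/- Let m ≥ 2 be an integer and n odd with 1 ≤ n ≤ 4m−1. For each choice of sign ±, there exists a function F_n^± ∈ C^∞([0,∞); ℂ) such that: (a) for all λ > 0 and all x, y ∈ ℝⁿ with x ≠ y, R₀^±(λ^{2m})(x,y) = λ^{(n+1)/2 − 2m} |x−y|^{−(n−1)/2} e^{±iλ|x−y|} F_n^±(λ|x−y|); (b) for every l ∈ ℕ₀ there is a constant C_l > 0 with |d^l F_n^±/dz^l (z)| ≤ C_l ⟨z⟩^{−l} for all z ≥ 0. -/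
open MeasureTheory Finset

/-- The coefficients `c_j` in the explicit formula for the free resolvent kernel. -/
noncomputable def cCoef (n : ℕ) (j : ℤ) : ℝ :=
  if j = -1 then -(1/2 : ℝ)
  else ((-2 : ℝ)) ^ j.toNat * (Nat.factorial (n - 3 - j.toNat)) /
      ((Nat.factorial j.toNat) * (Nat.factorial ((((n : ℤ) - 3) / 2 - j).toNat)))

/-- `λ_k = λ e^{ikπ/m}`. -/
noncomputable def lamK (m : ℕ) (lam : ℝ) (k : ℕ) : ℂ :=
  (lam : ℂ) * Complex.exp (Complex.I * (k : ℂ) * (Real.pi : ℂ) / (m : ℂ))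

/-- The limiting free resolvent kernel `R₀^±(λ^{2m})(x,y)` of `(-Δ)^m` on `ℝⁿ`, odd `n`,
as a function of `λ` and `r = |x - y|`.  The sign `+` corresponds to `sgn = true`
(with `I⁺ = {0, …, m-1}`), the sign `-` to `sgn = false` (with `I⁻ = {1, …, m}`). -/
noncomputable def R0Kernel (m n : ℕ) (sgn : Bool) (lam r : ℝ) : ℂ :=
  ((((4 * Real.pi) ^ (-(((n : ℝ) - 1) / 2)) : ℝ)) : ℂ) *
    ((m : ℂ) * (lam : ℂ) ^ (2 * m))⁻¹ *
    ∑ k ∈ (if sgn then Finset.range m else Finset.Icc 1 m),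
      (lamK m lam k) ^ 2 * Complex.exp (Complex.I * lamK m lam k * (r : ℂ)) *
        (r : ℂ) ^ (-((n : ℤ) - 2)) *
        ∑ j ∈ Finset.Icc (min 0 (((n : ℤ) - 3) / 2)) (((n : ℤ) - 3) / 2),
          ((cCoef n j : ℝ) : ℂ) * (Complex.I * lamK m lam k * (r : ℂ)) ^ j

/-- The function `z ↦ z^{-p} e^{βz}` of a real variable. -/
noncomputable def invPowExp (p : ℕ) (β : ℂ) (z : ℝ) : ℂ :=
  ((z : ℂ)⁻¹) ^ p * Complex.exp (β * z)

lemma contDiffAt_invPowExp (p : ℕ) (β : ℂ) {z : ℝ} (hz : 0 < z) (k : ℕ∞) :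
    ContDiffAt ℝ k (invPowExp p β) z := by
  have h : ContDiffAt ℝ k (fun x : ℝ => (x : ℂ)) z :=
    Complex.ofRealCLM.contDiff.contDiffAt
  unfold invPowExp
  have h0 : (z : ℂ) ≠ 0 := by exact_mod_cast hz.ne'
  exact ((h.inv h0).pow p).mul ((contDiffAt_const.mul h).cexp)

lemma deriv_invPowExp (p : ℕ) (β : ℂ) {z : ℝ} (hz : 0 < z) :
    deriv (invPowExp p β) z = β * invPowExp p β z - p * invPowExp (p + 1) β z := by
  have h0 : (z : ℂ) ≠ 0 := by exact_mod_cast hz.ne'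
  have h1 : HasDerivAt (fun x : ℂ => (x⁻¹) ^ p * Complex.exp (β * x))
      (β * ((z : ℂ)⁻¹ ^ p * Complex.exp (β * z)) -
        p * ((z : ℂ)⁻¹ ^ (p + 1) * Complex.exp (β * z))) (z : ℂ) := by
    refine (((hasDerivAt_inv h0).fun_pow p).mul
      (((hasDerivAt_id (z : ℂ)).const_mul β).cexp)).congr_deriv ?_
    rcases p with _ | p
    · simp; ring
    · simp only [Nat.add_sub_cancel, id, ← inv_pow]
      ring
  exact h1.comp_ofReal.deriv

lemma exists_pow_inv_bound_exp {b : ℝ} (hb : 0 < b) (N : ℕ) :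
    ∃ C : ℝ, ∀ z : ℝ, 1 ≤ z → Real.exp (-(b * z)) ≤ C * z⁻¹ ^ N := by
  refine ⟨N.factorial / b ^ N, fun z hz => ?_⟩
  have hz0 : 0 < z := by linarith
  have h := Real.pow_div_factorial_le_exp (x := b * z) (by positivity) N
  rw [Real.exp_neg]
  have : (N.factorial : ℝ) / b ^ N * z⁻¹ ^ N = ((b * z) ^ N / N.factorial)⁻¹ := by
    rw [mul_pow, inv_pow]; field_simp
  rw [this]
  exact inv_anti₀ (by positivity) h

lemma iteratedDeriv_invPowExp_bound {β : ℂ} (hβ : β = 0 ∨ β.re < 0) (l : ℕ) :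
    ∀ p N : ℕ, (β = 0 → N ≤ p + l) → ∃ C : ℝ, ∀ z : ℝ, 1 ≤ z →
      ‖iteratedDeriv l (invPowExp p β) z‖ ≤ C * z⁻¹ ^ N := by
  induction l with
  | zero =>
    intro p N hN
    rcases hβ with rfl | hβ
    · refine ⟨1, fun z hz => ?_⟩
      have hz0 : 0 < z := by linarith
      simpa [invPowExp, abs_of_pos hz0] using
        pow_le_pow_of_le_one (a := z⁻¹) (by positivity) (inv_le_one_of_one_le₀ hz) (hN rfl)
    · obtain ⟨C, hC⟩ := exists_pow_inv_bound_exp (b := -β.re) (by linarith) N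
      refine ⟨C, fun z hz => le_trans ?_ (hC z hz)⟩
      have hz0 : 0 < z := by linarith
      rw [iteratedDeriv_zero, invPowExp, norm_mul, Complex.norm_exp, norm_pow, norm_inv,
        Complex.norm_real, Real.norm_of_nonneg hz0.le]
      have : (β * z).re = -(-β.re * z) := by simp
      rw [this]
      exact mul_le_of_le_one_left (Real.exp_pos _).le
        (pow_le_one₀ (by positivity) (inv_le_one_of_one_le₀ hz))
  | succ l ih =>
    intro p N hN
    obtain ⟨C₂, h₂⟩ := ih (p + 1) N (fun h => by have := hN h; omega)
    have h₁ : ∃ C : ℝ, ∀ z : ℝ, 1 ≤ z →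
        ‖β * iteratedDeriv l (invPowExp p β) z‖ ≤ C * z⁻¹ ^ N := by
      by_cases hb : β = 0
      · exact ⟨0, fun z _ => by simp [hb]⟩
      · obtain ⟨C, hC⟩ := ih p N (fun h => absurd h hb)
        refine ⟨‖β‖ * C, fun z hz => ?_⟩
        rw [norm_mul, mul_assoc]
        exact mul_le_mul_of_nonneg_left (hC z hz) (norm_nonneg _)
    obtain ⟨C₁, h₁⟩ := h₁
    refine ⟨C₁ + p * C₂, fun z hz => ?_⟩
    have hz0 : 0 < z := by linarith
    have hev : deriv (invPowExp p β) =ᶠ[nhds z]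
        fun x => β * invPowExp p β x - p * invPowExp (p + 1) β x := by
      filter_upwards [lt_mem_nhds hz0] with x hx using deriv_invPowExp p β hx
    have hc := fun q => contDiffAt_invPowExp q β hz0 l
    rw [iteratedDeriv_succ', hev.iteratedDeriv_eq,
      iteratedDeriv_fun_sub (contDiffAt_const.mul (hc p)) (contDiffAt_const.mul (hc (p + 1))),
      iteratedDeriv_const_mul_field, iteratedDeriv_const_mul_field]
    refine (norm_sub_le _ _).trans ?_
    rw [add_mul]
    refine add_le_add (h₁ z hz) ?_
    rw [norm_mul, Complex.norm_natCast, mul_assoc]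
    exact mul_le_mul_of_nonneg_left (h₂ z hz) (Nat.cast_nonneg _)

/-- A smooth function which on `(0, ∞)` is a linear combination of terms `z^{-p} e^{βz}` with
`β = 0` or `re β < 0` is a symbol of order zero on `[0, ∞)`. -/
lemma symbol_bound_of_eq_sum {ι : Type*} (s : Finset ι) (a : ι → ℂ) (p : ι → ℕ) (β : ι → ℂ)
    (hβ : ∀ i ∈ s, β i = 0 ∨ (β i).re < 0) {F : ℝ → ℂ} (hF : ∀ k : ℕ, ContDiff ℝ k F)
    (h : ∀ z : ℝ, 0 < z → F z = ∑ i ∈ s, a i * invPowExp (p i) (β i) z) (l : ℕ) :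
    ∃ C : ℝ, 0 < C ∧ ∀ z : ℝ, 0 ≤ z →
      ‖iteratedDerivWithin l F (Set.Ici 0) z‖ ≤ C * Real.sqrt (1 + z ^ 2) ^ (-(l : ℤ)) := by
  have hlarge : ∃ C : ℝ, ∀ z : ℝ, 1 ≤ z → ‖iteratedDeriv l F z‖ ≤ C * z⁻¹ ^ l := by
    have hb : ∀ i ∈ s, ∃ C : ℝ, ∀ z : ℝ, 1 ≤ z →
        ‖iteratedDeriv l (invPowExp (p i) (β i)) z‖ ≤ C * z⁻¹ ^ l := fun i hi =>
      iteratedDeriv_invPowExp_bound (hβ i hi) l (p i) l (fun _ => by omega)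
    choose! C hC using hb
    refine ⟨∑ i ∈ s, ‖a i‖ * C i, fun z hz => ?_⟩
    have hz0 : 0 < z := by linarith
    have hev : F =ᶠ[nhds z] fun x => ∑ i ∈ s, a i * invPowExp (p i) (β i) x := by
      filter_upwards [lt_mem_nhds hz0] with x hx using h x hx
    rw [hev.iteratedDeriv_eq, iteratedDeriv_fun_sum fun i _ =>
      contDiffAt_const.mul (contDiffAt_invPowExp (p i) (β i) hz0 l), Finset.sum_mul]
    refine norm_sum_le_of_le _ fun i hi => ?_
    rw [iteratedDeriv_const_mul_field, norm_mul, mul_assoc]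
    exact mul_le_mul_of_nonneg_left (hC i hi z hz) (norm_nonneg _)
  obtain ⟨C₁, h₁⟩ := hlarge
  obtain ⟨C₂, h₂⟩ := (isCompact_Icc (a := (0 : ℝ)) (b := 1)).exists_bound_of_continuousOn
    ((hF l).continuous_iteratedDeriv l le_rfl).continuousOn
  refine ⟨(max |C₁| |C₂| + 1) * 2 ^ l, by positivity, fun z hz => ?_⟩
  rw [iteratedDerivWithin_eq_iteratedDeriv (uniqueDiffOn_Ici 0) (hF l).contDiffAt hz,
    zpow_neg, zpow_natCast, ← inv_pow, mul_assoc, ← mul_pow]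
  have hs : 0 < Real.sqrt (1 + z ^ 2) := Real.sqrt_pos.2 (by positivity)
  have hC₁ : C₁ ≤ max |C₁| |C₂| + 1 := by
    linarith [le_abs_self C₁, le_max_left |C₁| |C₂|]
  have hC₂ : C₂ ≤ max |C₁| |C₂| + 1 := by
    linarith [le_abs_self C₂, le_max_right |C₁| |C₂|]
  rcases le_total z 1 with hz1 | hz1
  · refine (h₂ z ⟨hz, hz1⟩).trans (hC₂.trans (le_mul_of_one_le_right (by positivity) ?_))
    refine one_le_pow₀ ?_
    rw [← div_eq_mul_inv, one_le_div hs]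
    exact Real.sqrt_le_iff.2 ⟨by norm_num, by nlinarith⟩
  · have hz0 : 0 < z := by linarith
    refine (h₁ z hz1).trans (mul_le_mul hC₁ ?_ (by positivity) (by positivity))
    refine pow_le_pow_left₀ (by positivity) ?_ l
    rw [← div_eq_mul_inv, inv_eq_one_div, div_le_div_iff₀ hz0 hs, one_mul]
    exact Real.sqrt_le_iff.2 ⟨by positivity, by nlinarith⟩

/-- The coefficient of `w^j` in `reverseBessel d`. -/
noncomputable def reverseBesselCoeff (d j : ℕ) : ℂ :=
  (-2) ^ j * (2 * d - j).factorial / (j.factorial * (d - j).factorial)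

/-- A reverse Bessel polynomial, evaluated at `-w` and rescaled. -/
noncomputable def reverseBessel (d : ℕ) (w : ℂ) : ℂ :=
  ∑ j ∈ Finset.range (d + 1), reverseBesselCoeff d j * w ^ j

lemma reverseBesselCoeff_self_succ (d : ℕ) :
    reverseBesselCoeff (d + 1) (d + 1) = -2 * reverseBesselCoeff d d := by
  have h (k : ℕ) : reverseBesselCoeff k k = (-2) ^ k := by
    have : (k.factorial : ℂ) ≠ 0 := by exact_mod_cast k.factorial_ne_zero
    simp [reverseBesselCoeff, two_mul, this]
  rw [h, h, pow_succ]; ring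

lemma reverseBesselCoeff_zero_add_one (d : ℕ) :
    reverseBesselCoeff (d + 1) 0 + reverseBesselCoeff (d + 1) 1 = 0 := by
  have h1 : (d.factorial : ℂ) ≠ 0 := by exact_mod_cast d.factorial_ne_zero
  have h2 : (d : ℂ) + 1 ≠ 0 := by exact_mod_cast d.succ_ne_zero
  have e : 2 * (d + 1) = (2 * d + 1) + 1 := by ring
  simp only [reverseBesselCoeff, e, Nat.add_sub_cancel, Nat.sub_zero, Nat.factorial_succ (2 * d + 1),
    Nat.factorial_succ d, Nat.factorial_zero, Nat.factorial_one]
  generalize (2 * d + 1).factorial = X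
  push_cast
  field_simp
  ring

lemma reverseBesselCoeff_recurrence {d j : ℕ} (hj : j < d) :
    reverseBesselCoeff (d + 1) (j + 1) + (j + 2) * reverseBesselCoeff (d + 1) (j + 2) =
      -2 * reverseBesselCoeff d j := by
  obtain ⟨e, rfl⟩ := Nat.exists_eq_add_of_lt hj
  have e1 : 2 * (j + e + 1 + 1) - (j + 1) = (j + 2 * e + 2) + 1 := by omega
  have e2 : 2 * (j + e + 1 + 1) - (j + 2) = j + 2 * e + 2 := by omega
  have e3 : 2 * (j + e + 1) - j = j + 2 * e + 2 := by omega
  have e4 : j + e + 1 + 1 - (j + 1) = e + 1 := by omega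
  have e5 : j + e + 1 + 1 - (j + 2) = e := by omega
  have e6 : j + e + 1 - j = e + 1 := by omega
  have h1 : (j.factorial : ℂ) ≠ 0 := by exact_mod_cast j.factorial_ne_zero
  have h2 : (e.factorial : ℂ) ≠ 0 := by exact_mod_cast e.factorial_ne_zero
  have h3 : (j : ℂ) + 1 ≠ 0 := by exact_mod_cast j.succ_ne_zero
  have h4 : (j : ℂ) + 2 ≠ 0 := by exact_mod_cast (j + 1).succ_ne_zero
  have h5 : (e : ℂ) + 1 ≠ 0 := by exact_mod_cast e.succ_ne_zero
  have h6 : (j : ℂ) + 1 + 1 ≠ 0 := by rwa [add_assoc, one_add_one_eq_two]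
  simp only [reverseBesselCoeff, e1, e2, e3, e4, e5, e6]
  rw [Nat.factorial_succ (j + 2 * e + 2), Nat.factorial_succ e, Nat.factorial_succ (j + 1),
    Nat.factorial_succ j]
  generalize (j + 2 * e + 2).factorial = X
  push_cast
  field_simp
  ring

lemma hasDerivAt_exp_mul_reverseBessel (d : ℕ) (w : ℂ) :
    HasDerivAt (fun w => Complex.exp w * reverseBessel (d + 1) w)
      (-2 * w * (Complex.exp w * reverseBessel d w)) w := by
  have hP : HasDerivAt (reverseBessel (d + 1))
      (∑ j ∈ Finset.range (d + 2), reverseBesselCoeff (d + 1) j * (j * w ^ (j - 1))) w :=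
    HasDerivAt.fun_sum fun j _ => (hasDerivAt_pow j w).const_mul _
  refine ((Complex.hasDerivAt_exp w).mul hP).congr_deriv ?_
  suffices h : reverseBessel (d + 1) w + ∑ j ∈ Finset.range (d + 2),
      reverseBesselCoeff (d + 1) j * (j * w ^ (j - 1)) = -2 * w * reverseBessel d w by
    linear_combination Complex.exp w * h
  rw [reverseBessel, Finset.sum_range_succ, Finset.sum_range_succ' (n := d + 1)]
  rw [Finset.sum_range_succ' (n := d), Finset.sum_range_succ' (n := d), reverseBessel,
    Finset.sum_range_succ, mul_add, Finset.mul_sum]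
  have hsum : ∑ j ∈ Finset.range d, -2 * w * (reverseBesselCoeff d j * w ^ j) =
      ∑ j ∈ Finset.range d, reverseBesselCoeff (d + 1) (j + 1) * w ^ (j + 1) +
      ∑ j ∈ Finset.range d, reverseBesselCoeff (d + 1) (j + 1 + 1) *
        ((j + 1 + 1 : ℕ) * w ^ (j + 1 + 1 - 1)) := by
    rw [← Finset.sum_add_distrib]
    refine Finset.sum_congr rfl fun j hj => ?_
    have := reverseBesselCoeff_recurrence (Finset.mem_range.1 hj)
    push_cast
    linear_combination -w ^ (j + 1) * this
  rw [hsum]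
  have h0 := reverseBesselCoeff_zero_add_one d
  have h1 := reverseBesselCoeff_self_succ d
  simp
  linear_combination h0 + w ^ (d + 1) * h1

/-- The sum `∑_k ω_k^q e^{iω_k z} P_d(iω_k z)` over a finite family of points. -/
noncomputable def besselSum (s : Finset ℕ) (ω : ℕ → ℂ) (d q : ℕ) (z : ℂ) : ℂ :=
  ∑ k ∈ s, ω k ^ q *
    (Complex.exp (Complex.I * ω k * z) * reverseBessel d (Complex.I * ω k * z))

lemma differentiable_besselSum (s : Finset ℕ) (ω : ℕ → ℂ) (d q : ℕ) :
    Differentiable ℂ (besselSum s ω d q) := by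
  unfold besselSum reverseBessel
  fun_prop

lemma besselSum_zero (s : Finset ℕ) (ω : ℕ → ℂ) (d q : ℕ) :
    besselSum s ω d q 0 = (∑ k ∈ s, ω k ^ q) * reverseBessel d 0 := by
  simp [besselSum, Finset.sum_mul]

lemma deriv_besselSum (s : Finset ℕ) (ω : ℕ → ℂ) (d q : ℕ) :
    deriv (besselSum s ω (d + 1) q) = fun z => z * (2 * besselSum s ω d (q + 2) z) := by
  funext z
  have h : HasDerivAt (besselSum s ω (d + 1) q)
      (∑ k ∈ s, ω k ^ q * (-2 * (Complex.I * ω k * z) * (Complex.exp (Complex.I * ω k * z) *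
        reverseBessel d (Complex.I * ω k * z)) * (Complex.I * ω k))) z := by
    refine HasDerivAt.fun_sum fun k _ => HasDerivAt.const_mul _ ?_
    have := (hasDerivAt_exp_mul_reverseBessel d (Complex.I * ω k * z)).comp z
      ((hasDerivAt_id z).const_mul (Complex.I * ω k))
    simpa [Function.comp_def] using this
  rw [h.deriv, besselSum, Finset.mul_sum, Finset.mul_sum]
  refine Finset.sum_congr rfl fun k _ => ?_
  linear_combination (-2 * ω k ^ (q + 2) * z * (Complex.exp (Complex.I * ω k * z) *
    reverseBessel d (Complex.I * ω k * z))) * Complex.I_sq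

/-- Cancellation of even power sums forces `besselSum` to vanish at the origin. -/
lemma le_analyticOrderAt_besselSum (s : Finset ℕ) (ω : ℕ → ℂ) {M : ℕ}
    (hω : ∀ q, 0 < q → Even q → q < M → ∑ k ∈ s, ω k ^ q = 0) (d : ℕ) :
    ∀ q e : ℕ, 0 < q → Even q → e ≤ 2 * d + 1 → e + q ≤ M →
      (e : ℕ∞) ≤ analyticOrderAt (besselSum s ω d q) 0 := by
  induction d with
  | zero =>
    intro q e hq hqe he hM
    rcases Nat.eq_zero_or_pos e with rfl | hpos
    · simp
    obtain rfl : e = 1 := by omega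
    rw [Nat.cast_one, Order.one_le_iff_ne_zero,
      ((differentiable_besselSum s ω 0 q).analyticAt 0).analyticOrderAt_ne_zero, besselSum_zero,
      hω q hq hqe (by omega), zero_mul]
  | succ d ih =>
    intro q e hq hqe he hM
    rcases Nat.eq_zero_or_pos e with rfl | hpos
    · simp
    have h0 : besselSum s ω (d + 1) q 0 = 0 := by
      rw [besselSum_zero, hω q hq hqe (by omega), zero_mul]
    have han := (differentiable_besselSum s ω (d + 1) q).analyticAt 0
    have h := han.analyticOrderAt_deriv_add_one
    simp only [h0, sub_zero] at h
    rw [← h]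
    obtain ⟨e, rfl⟩ : ∃ e', e = e' + 1 := ⟨e - 1, by omega⟩
    rw [Nat.cast_add, Nat.cast_one]
    refine add_le_add_left ?_ 1
    rcases Nat.eq_zero_or_pos e with rfl | hpos'
    · simp
    obtain ⟨e, rfl⟩ : ∃ e', e = e' + 1 := ⟨e - 1, by omega⟩
    have hd := (differentiable_besselSum s ω d (q + 2)).analyticAt 0
    obtain ⟨g, hg, hge⟩ := (natCast_le_analyticOrderAt hd).1
      (ih (q + 2) e (by omega) (hqe.add even_two) (by omega) (by omega))
    rw [deriv_besselSum, natCast_le_analyticOrderAt (by fun_prop)]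
    refine ⟨fun z => 2 * g z, by fun_prop, ?_⟩
    filter_upwards [hge] with z hz
    rw [hz]
    simp only [sub_zero, smul_eq_mul]
    ring

/-- An entire function vanishing to order `e` at the origin is `z^e` times an entire function. -/
lemma exists_entire_factor {f : ℂ → ℂ} (hf : Differentiable ℂ f) {e : ℕ}
    (h : (e : ℕ∞) ≤ analyticOrderAt f 0) :
    ∃ g : ℂ → ℂ, Differentiable ℂ g ∧ ∀ z, f z = z ^ e * g z := by
  obtain ⟨g, hg, hge⟩ := (natCast_le_analyticOrderAt (hf.analyticAt 0)).1 h
  simp only [sub_zero, smul_eq_mul] at hge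
  refine ⟨Function.update (fun z => f z / z ^ e) 0 (g 0), fun z => ?_, fun z => ?_⟩
  · rcases eq_or_ne z 0 with rfl | hz
    · refine hg.differentiableAt.congr_of_eventuallyEq ?_
      filter_upwards [hge] with x hx
      rcases eq_or_ne x 0 with rfl | hx0
      · simp
      · rw [Function.update_of_ne hx0, hx]
        field_simp
    · have : DifferentiableAt ℂ (fun z => f z / z ^ e) z :=
        (hf z).div (by fun_prop) (pow_ne_zero _ hz)
      refine this.congr_of_eventuallyEq ?_
      filter_upwards [isOpen_ne.mem_nhds hz] with x hx
      rw [Function.update_of_ne hx]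
  · rcases eq_or_ne z 0 with rfl | hz
    · simpa using hge.self_of_nhds
    · rw [Function.update_of_ne hz]
      field_simp

/-- The point `e^{ikπ/m}` of the unit circle. -/
noncomputable def unitRoot (m k : ℕ) : ℂ :=
  Complex.exp (Complex.I * (k : ℂ) * (Real.pi : ℂ) / (m : ℂ))

lemma lamK_eq (m : ℕ) (lam : ℝ) (k : ℕ) : lamK m lam k = lam * unitRoot m k := rfl

lemma sum_unitRoot_pow_eq_zero {m : ℕ} (hm : 0 < m) (sgn : Bool) {q : ℕ} (hq : 0 < q)
    (hqe : Even q) (hqm : q < 2 * m) :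
    ∑ k ∈ (if sgn then Finset.range m else Finset.Icc 1 m), unitRoot m k ^ q = 0 := by
  obtain ⟨c, rfl⟩ := hqe
  set ζ : ℂ := Complex.exp (2 * Real.pi * Complex.I / m) with hζ
  have hprim : IsPrimitiveRoot ζ m := Complex.isPrimitiveRoot_exp m hm.ne'
  have hpow : ∀ k, unitRoot m k ^ (c + c) = (ζ ^ c) ^ k := fun k => by
    rw [unitRoot, hζ, ← Complex.exp_nat_mul, ← Complex.exp_nat_mul, ← Complex.exp_nat_mul]
    congr 1
    push_cast
    ring
  have hne : ζ ^ c ≠ 1 := hprim.pow_ne_one_of_pos_of_lt (by omega) (by omega)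
  have hone : (ζ ^ c) ^ m = 1 := by rw [← pow_mul, mul_comm, pow_mul, hprim.pow_eq_one, one_pow]
  have hsum : ∑ k ∈ Finset.range m, (ζ ^ c) ^ k = 0 := by
    rw [geom_sum_eq hne, hone, sub_self, zero_div]
  simp only [hpow]
  cases sgn
  · rw [if_neg (by simp), ← Finset.Ico_add_one_right_eq_Icc, Finset.sum_Ico_eq_sum_range]
    simp only [Nat.add_sub_cancel, pow_add, ← Finset.mul_sum, hsum, mul_zero]
  · simpa using hsum

/-- The sign `±1` attached to a Boolean. -/
noncomputable def signOf (sgn : Bool) : ℂ := if sgn then 1 else -1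

lemma unitRoot_phase {m : ℕ} (hm : 0 < m) (sgn : Bool) {k : ℕ}
    (hk : k ∈ (if sgn then Finset.range m else Finset.Icc 1 m)) :
    Complex.I * (unitRoot m k - signOf sgn) = 0 ∨
      (Complex.I * (unitRoot m k - signOf sgn)).re < 0 := by
  have hm0 : (0 : ℝ) < m := by exact_mod_cast hm
  have hu : unitRoot m k = Complex.exp (((k * Real.pi / m : ℝ) : ℂ) * Complex.I) := by
    rw [unitRoot]
    congr 1
    push_cast
    ring
  have hre : (Complex.I * (unitRoot m k - signOf sgn)).re = -Real.sin (k * Real.pi / m) := by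
    have him : (signOf sgn).im = 0 := by cases sgn <;> simp [signOf]
    rw [Complex.I_mul_re, Complex.sub_im, him, hu, Complex.exp_ofReal_mul_I_im, sub_zero]
  have hneg (h0 : 0 < k) (h1 : k < m) :
      (Complex.I * (unitRoot m k - signOf sgn)).re < 0 := by
    have h0' : (0 : ℝ) < k := by exact_mod_cast h0
    have h1' : (k : ℝ) < m := by exact_mod_cast h1
    rw [hre, neg_lt_zero]
    refine Real.sin_pos_of_pos_of_lt_pi (by positivity) ?_
    rw [div_lt_iff₀ hm0, mul_comm]
    exact mul_lt_mul_of_pos_left h1' Real.pi_pos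
  cases sgn
  · simp only [Bool.false_eq_true, if_false, Finset.mem_Icc] at hk
    rcases hk.2.lt_or_eq with h | rfl
    · exact Or.inr (hneg hk.1 h)
    · left
      rw [hu, mul_div_cancel_left₀ _ hm0.ne', Complex.exp_pi_mul_I]
      simp [signOf]
  · simp only [if_true, Finset.mem_range] at hk
    rcases Nat.eq_zero_or_pos k with rfl | h
    · left
      simp [unitRoot, signOf]
    · exact Or.inr (hneg h hk)

lemma sum_cCoef_zpow (d : ℕ) (w : ℂ) :
    ∑ j ∈ Finset.Icc (min 0 ((((2 * d + 3 : ℕ) : ℤ) - 3) / 2)) ((((2 * d + 3 : ℕ) : ℤ) - 3) / 2),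
      ((cCoef (2 * d + 3) j : ℝ) : ℂ) * w ^ j = reverseBessel d w := by
  have h : (((2 * d + 3 : ℕ) : ℤ) - 3) / 2 = d := by omega
  rw [h, min_eq_left (by omega), reverseBessel]
  symm
  refine Finset.sum_nbij' (fun j => (j : ℤ)) Int.toNat ?_ ?_ ?_ ?_ ?_
  · intro j hj
    simp only [Finset.mem_range, Finset.mem_Icc] at *
    omega
  · intro j hj
    simp only [Finset.mem_range, Finset.mem_Icc] at *
    omega
  · intro j _
    simp
  · intro j hj
    simp only [Finset.mem_Icc] at hj
    omega
  · intro j _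
    have h1 : ((j : ℤ)) ≠ -1 := by omega
    have h2 : ((d : ℤ) - j).toNat = d - j := by omega
    rw [cCoef, if_neg h1, h, h2, Int.toNat_natCast, zpow_natCast, reverseBesselCoeff]
    push_cast
    rfl

/-- The leading constant `(4π)^{-(n-1)/2} / m` of the kernel. -/
noncomputable def kernelConst (m n : ℕ) : ℂ :=
  ((((4 * Real.pi) ^ (-(((n : ℝ) - 1) / 2)) : ℝ)) : ℂ) * (m : ℂ)⁻¹

lemma exists_F_dim_one (m : ℕ) (hm : 0 < m) (sgn : Bool) :
    ∃ F : ℝ → ℂ, (∀ k : ℕ, ContDiff ℝ k F) ∧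
      (∀ lam r : ℝ, 0 < lam → 0 < r → R0Kernel m 1 sgn lam r =
          (((lam ^ ((((1 : ℕ) : ℤ) + 1) / 2 - 2 * (m : ℤ))) : ℝ) : ℂ) *
            (((r ^ (-((((1 : ℕ) : ℤ) - 1) / 2))) : ℝ) : ℂ) *
            Complex.exp (signOf sgn * Complex.I * (lam : ℂ) * (r : ℂ)) * F (lam * r)) ∧
      (∀ l : ℕ, ∃ C : ℝ, 0 < C ∧ ∀ z : ℝ, 0 ≤ z →
        ‖iteratedDerivWithin l F (Set.Ici 0) z‖ ≤
          C * Real.sqrt (1 + z ^ 2) ^ (-(l : ℤ))) := by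
  set s := if sgn then Finset.range m else Finset.Icc 1 m with hs
  set a : ℕ → ℂ := fun k =>
    kernelConst m 1 * (unitRoot m k ^ 2 * (-(1 / 2) * (Complex.I * unitRoot m k)⁻¹)) with ha
  set β : ℕ → ℂ := fun k => Complex.I * (unitRoot m k - signOf sgn) with hβ
  have hF : ∀ k : ℕ, ContDiff ℝ k fun z : ℝ => ∑ i ∈ s, a i * invPowExp 0 (β i) z := fun k => by
    have h : ContDiff ℝ k (fun x : ℝ => (x : ℂ)) := Complex.ofRealCLM.contDiff
    simp only [invPowExp, pow_zero, one_mul]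
    exact ContDiff.sum fun i _ => contDiff_const.mul (contDiff_const.mul h).cexp
  refine ⟨_, hF, fun lam r hlam hr => ?_,
    symbol_bound_of_eq_sum s a (fun _ => 0) β (fun i hi => unitRoot_phase hm sgn hi) hF
      fun _ _ => rfl⟩
  have hl : (lam : ℂ) ≠ 0 := by exact_mod_cast hlam.ne'
  have hr' : (r : ℂ) ≠ 0 := by exact_mod_cast hr.ne'
  have hm0 : (m : ℂ) ≠ 0 := by exact_mod_cast hm.ne'
  have e1 : (((1 : ℕ) : ℤ) - 3) / 2 = -1 := by norm_num
  have e2 : (((1 : ℕ) : ℤ) + 1) / 2 - 2 * (m : ℤ) = 1 - ((2 * m : ℕ) : ℤ) := by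
    push_cast; norm_num
  have e3 : -((((1 : ℕ) : ℤ) - 1) / 2) = 0 := by norm_num
  have e4 : -(((1 : ℕ) : ℤ) - 2) = 1 := by norm_num
  have e5 : min (0 : ℤ) (-1) = -1 := by norm_num
  rw [R0Kernel, e1, e2, e3, e4, e5, Finset.Icc_self, ← hs, Finset.mul_sum, Finset.mul_sum]
  refine Finset.sum_congr rfl fun k _ => ?_
  have hu : unitRoot m k ≠ 0 := Complex.exp_ne_zero _
  have hexp : Complex.exp (Complex.I * (lam * unitRoot m k) * r) =
      Complex.exp (signOf sgn * Complex.I * lam * r) *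
        Complex.exp (Complex.I * (unitRoot m k - signOf sgn) * ((lam * r : ℝ) : ℂ)) := by
    rw [← Complex.exp_add]
    congr 1
    push_cast
    ring
  simp only [Finset.sum_singleton, cCoef, if_true, lamK_eq, hexp, invPowExp, ha, hβ, kernelConst,
    pow_zero, zpow_one, zpow_zero, zpow_neg_one]
  rw [Complex.ofReal_zpow, zpow_sub₀ hl, zpow_one, zpow_natCast]
  push_cast
  have hI := Complex.I_ne_zero
  field_simp

lemma exists_F_dim_ge_three (m d : ℕ) (hm : 0 < m) (hd : 2 * d + 3 ≤ 4 * m - 1) (sgn : Bool) :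
    ∃ F : ℝ → ℂ, (∀ k : ℕ, ContDiff ℝ k F) ∧
      (∀ lam r : ℝ, 0 < lam → 0 < r → R0Kernel m (2 * d + 3) sgn lam r =
          (((lam ^ ((((2 * d + 3 : ℕ) : ℤ) + 1) / 2 - 2 * (m : ℤ))) : ℝ) : ℂ) *
            (((r ^ (-((((2 * d + 3 : ℕ) : ℤ) - 1) / 2))) : ℝ) : ℂ) *
            Complex.exp (signOf sgn * Complex.I * (lam : ℂ) * (r : ℂ)) * F (lam * r)) ∧
      (∀ l : ℕ, ∃ C : ℝ, 0 < C ∧ ∀ z : ℝ, 0 ≤ z →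
        ‖iteratedDerivWithin l F (Set.Ici 0) z‖ ≤
          C * Real.sqrt (1 + z ^ 2) ^ (-(l : ℤ))) := by
  set s := if sgn then Finset.range m else Finset.Icc 1 m with hs
  obtain ⟨H, hH, hfac⟩ := exists_entire_factor (differentiable_besselSum s (unitRoot m) d 2)
    (le_analyticOrderAt_besselSum s (unitRoot m) (M := 2 * m)
      (fun q h0 h1 h2 => sum_unitRoot_pow_eq_zero hm sgn h0 h1 h2) d 2 d (by norm_num) even_two
      (by omega) (by omega))
  set A := kernelConst m (2 * d + 3) with hA
  have hF : ∀ k : ℕ, ContDiff ℝ k fun z : ℝ =>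
      A * (Complex.exp (-(signOf sgn * Complex.I * z)) * H z) := fun k => by
    have h : ContDiff ℝ k (fun x : ℝ => (x : ℂ)) := Complex.ofRealCLM.contDiff
    have hHk : ContDiff ℝ k H := (hH.contDiff (n := k)).restrict_scalars ℝ
    exact contDiff_const.mul ((contDiff_const.mul h).neg.cexp.mul (hHk.comp h))
  have hHz : ∀ z : ℝ, 0 < z → H z = (z : ℂ)⁻¹ ^ d * besselSum s (unitRoot m) d 2 z := fun z hz => by
    have hz' : (z : ℂ) ≠ 0 := by exact_mod_cast hz.ne'
    rw [hfac, ← mul_assoc, ← mul_pow, inv_mul_cancel₀ hz', one_pow, one_mul]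
  refine ⟨_, hF, fun lam r hlam hr => ?_,
    symbol_bound_of_eq_sum (s ×ˢ Finset.range (d + 1))
      (fun i => A * (unitRoot m i.1 ^ 2 *
        (reverseBesselCoeff d i.2 * (Complex.I * unitRoot m i.1) ^ i.2)))
      (fun i => d - i.2) (fun i => Complex.I * (unitRoot m i.1 - signOf sgn))
      (fun i hi => unitRoot_phase hm sgn (Finset.mem_product.1 hi).1) hF fun z hz => ?_⟩
  · have hl : (lam : ℂ) ≠ 0 := by exact_mod_cast hlam.ne'
    have hr' : (r : ℂ) ≠ 0 := by exact_mod_cast hr.ne'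
    have hm0 : (m : ℂ) ≠ 0 := by exact_mod_cast hm.ne'
    have e2 : (((2 * d + 3 : ℕ) : ℤ) + 1) / 2 - 2 * (m : ℤ) =
        ((d + 2 : ℕ) : ℤ) - ((2 * m : ℕ) : ℤ) := by omega
    have e3 : -((((2 * d + 3 : ℕ) : ℤ) - 1) / 2) = -((d + 1 : ℕ) : ℤ) := by omega
    have e4 : -(((2 * d + 3 : ℕ) : ℤ) - 2) = -((2 * d + 1 : ℕ) : ℤ) := by omega
    rw [R0Kernel, ← hs]
    simp only [sum_cCoef_zpow]
    rw [e2, e3, e4, hHz _ (mul_pos hlam hr), Complex.ofReal_zpow, Complex.ofReal_zpow,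
      zpow_sub₀ hl, zpow_neg, zpow_neg, zpow_natCast, zpow_natCast, zpow_natCast, zpow_natCast,
      besselSum]
    simp only [Finset.mul_sum]
    refine Finset.sum_congr rfl fun k _ => ?_
    have h1 : Complex.I * lamK m lam k * r = Complex.I * unitRoot m k * ((lam * r : ℝ) : ℂ) := by
      rw [lamK_eq]
      push_cast
      ring
    have h2 : Complex.exp (-(signOf sgn * Complex.I * ((lam * r : ℝ) : ℂ))) =
        (Complex.exp (signOf sgn * Complex.I * lam * r))⁻¹ := by
      rw [← Complex.exp_neg]
      congr 1
      push_cast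
      ring
    rw [h1, h2, lamK_eq, hA, kernelConst]
    have h3 := Complex.exp_ne_zero (signOf sgn * Complex.I * lam * r)
    generalize Complex.exp (signOf sgn * Complex.I * lam * r) = E at h3 ⊢
    generalize Complex.exp (Complex.I * unitRoot m k * ((lam * r : ℝ) : ℂ)) = E'
    generalize reverseBessel d (Complex.I * unitRoot m k * ((lam * r : ℝ) : ℂ)) = P
    push_cast
    rw [inv_pow]
    field_simp
    ring
  · have hz' : (z : ℂ) ≠ 0 := by exact_mod_cast hz.ne'
    rw [hHz z hz, besselSum, Finset.sum_product]
    simp only [reverseBessel, Finset.mul_sum]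
    refine Finset.sum_congr rfl fun k _ => Finset.sum_congr rfl fun j hj => ?_
    have hexp : Complex.exp (Complex.I * (unitRoot m k - signOf sgn) * z) =
        Complex.exp (-(signOf sgn * Complex.I * z)) * Complex.exp (Complex.I * unitRoot m k * z) := by
      rw [← Complex.exp_add]
      congr 1
      ring
    have hpow : (z : ℂ)⁻¹ ^ d * (z : ℂ) ^ j = (z : ℂ)⁻¹ ^ (d - j) := by
      have hjd : j ≤ d := Nat.lt_succ_iff.1 (Finset.mem_range.1 hj)
      obtain ⟨e, rfl⟩ := Nat.exists_eq_add_of_le hjd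
      rw [Nat.add_sub_cancel_left, pow_add, mul_right_comm, ← mul_pow, inv_mul_cancel₀ hz',
        one_pow, one_mul]
    rw [invPowExp, hexp, ← hpow]
    ring

/-- Representation `R₀^±(λ^{2m})(x,y) = λ^{(n+1)/2-2m} |x-y|^{-(n-1)/2} e^{±iλ|x-y|}
F_n^±(λ|x-y|)` with `F_n^±` smooth on `[0, ∞)` and `|∂^l F_n^±(z)| ≤ C_l ⟨z⟩^{-l}`. -/
theorem free_resolvent_F_representation
    (m n : ℕ) (hm : 2 ≤ m) (hodd : Odd n) (hn1 : 1 ≤ n) (hn2 : n ≤ 4 * m - 1)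
    (sgn : Bool) :
    ∃ F : ℝ → ℂ,
      (∀ k : ℕ, ContDiffOn ℝ k F (Set.Ici 0)) ∧
      (∀ lam : ℝ, 0 < lam → ∀ x y : EuclideanSpace ℝ (Fin n), x ≠ y →
        R0Kernel m n sgn lam (dist x y) =
          (((lam ^ (((n : ℤ) + 1) / 2 - 2 * (m : ℤ))) : ℝ) : ℂ) *
            (((dist x y ^ (-(((n : ℤ) - 1) / 2))) : ℝ) : ℂ) *
            Complex.exp ((if sgn then (1 : ℂ) else -1) * Complex.I * (lam : ℂ) *
              ((dist x y : ℝ) : ℂ)) *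
            F (lam * dist x y)) ∧
      (∀ l : ℕ, ∃ C : ℝ, 0 < C ∧ ∀ z : ℝ, 0 ≤ z →
        ‖iteratedDerivWithin l F (Set.Ici 0) z‖ ≤
          C * Real.sqrt (1 + z ^ 2) ^ (-(l : ℤ))) := by
  have key : ∃ F : ℝ → ℂ, (∀ k : ℕ, ContDiff ℝ k F) ∧
      (∀ lam r : ℝ, 0 < lam → 0 < r → R0Kernel m n sgn lam r =
          (((lam ^ (((n : ℤ) + 1) / 2 - 2 * (m : ℤ))) : ℝ) : ℂ) *
            (((r ^ (-(((n : ℤ) - 1) / 2))) : ℝ) : ℂ) *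
            Complex.exp (signOf sgn * Complex.I * (lam : ℂ) * (r : ℂ)) * F (lam * r)) ∧
      (∀ l : ℕ, ∃ C : ℝ, 0 < C ∧ ∀ z : ℝ, 0 ≤ z →
        ‖iteratedDerivWithin l F (Set.Ici 0) z‖ ≤
          C * Real.sqrt (1 + z ^ 2) ^ (-(l : ℤ))) := by
    obtain ⟨_ | d, rfl⟩ := hodd
    · exact exists_F_dim_one m (by omega) sgn
    · exact exists_F_dim_ge_three m d (by omega) (by omega) sgn
  obtain ⟨F, hF, hrep, hbound⟩ := key
  exact ⟨F, fun k => (hF k).contDiffOn,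
    fun lam hlam x y hxy => hrep lam _ hlam (dist_pos.2 hxy), hbound⟩
end

section
/- Let λ₀ > 0 and let χ be a smooth cutoff on ℝ with χ(λ) = 1 for |λ| ≤ λ₀/2 and χ(λ) = 0 for |λ| ≥ λ₀. Let b > −1 be real, let k be an integer with k > b+1, and let f ∈ C^k((0,∞); ℂ) satisfy |f^{(l)}(λ)| ≤ A λ^{b−l} for all λ ∈ (0, λ₀] and all 0 ≤ l ≤ k, for some A > 0. Then the integral ∫₀^∞ e^{iλx} f(λ) χ(λ) dλ converges absolutely for every x ∈ ℝ, and there is a constant C depending only on b, k and χ such that |∫₀^∞ e^{iλx} f(λ) χ(λ) dλ| ≤ C A ⟨x⟩^{−(b+1)} for all x ∈ ℝ. -/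
open MeasureTheory

open Set

/-- Non-stationary phase away from the origin: if the successive derivatives `G l` of `G 0` satisfy
symbol bounds of order `b < n - 1` on `(0, ∞)`, then `n` integrations by parts on `[|x|⁻¹, M]`
give decay of order `b + 1` in `x`. -/
lemma norm_integral_exp_mul_le_of_symbol_bound (n : ℕ) :
    ∀ (b A x M : ℝ) (G : ℕ → ℝ → ℂ), b + 1 < n → 0 ≤ A → x ≠ 0 → |x|⁻¹ ≤ M →
      (∀ l < n, ∀ t > 0, HasDerivAt (G l) (G (l + 1) t) t) →
      (∀ l ≤ n, ContinuousOn (G l) (Ioi 0)) →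
      (∀ l ≤ n, ∀ t > 0, ‖G l t‖ ≤ A * t ^ (b - l)) →
      (∀ l ≤ n, G l M = 0) →
      ‖∫ t in |x|⁻¹..M, Complex.exp (Complex.I * t * x) * G 0 t‖ ≤
        A * (n + 1 / (n - (b + 1))) * |x| ^ (-(b + 1)) := by
  have hexp (t x : ℝ) : ‖Complex.exp (Complex.I * t * x)‖ = 1 := by
    rw [show Complex.I * t * x = ((t * x : ℝ) : ℂ) * Complex.I by push_cast; ring]
    exact Complex.norm_exp_ofReal_mul_I _
  induction n with
  | zero =>
    intro b A x M G hb hA hx hM _ hc hG _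
    have hx' : 0 < |x|⁻¹ := by positivity
    have hb' : b + 1 < 0 := by simpa using hb
    have h0 : (0 : ℝ) ∉ uIcc |x|⁻¹ M := by
      rw [uIcc_of_le hM]; exact fun h => absurd h.1 (not_le.2 hx')
    have hle : ‖∫ t in |x|⁻¹..M, Complex.exp (Complex.I * t * x) * G 0 t‖ ≤
        ∫ t in |x|⁻¹..M, A * t ^ b := by
      refine intervalIntegral.norm_integral_le_of_norm_le hM (ae_of_all _ fun t ht => ?_)
        ((intervalIntegral.intervalIntegrable_rpow (Or.inr h0)).const_mul A)
      rw [norm_mul, hexp, one_mul]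
      simpa using hG 0 le_rfl t (hx'.trans ht.1)
    refine hle.trans ?_
    rw [intervalIntegral.integral_const_mul, integral_rpow (Or.inr ⟨by linarith, h0⟩)]
    have hM0 : 0 ≤ M ^ (b + 1) := Real.rpow_nonneg (hx'.le.trans hM) _
    rw [Real.inv_rpow (abs_nonneg x), ← Real.rpow_neg (abs_nonneg x), mul_assoc]
    refine mul_le_mul_of_nonneg_left ?_ hA
    rw [div_eq_mul_inv, ← neg_mul_neg, ← inv_neg]
    have : 0 < (-(b + 1))⁻¹ := inv_pos.2 (by linarith)
    simp only [Nat.cast_zero, zero_add, zero_sub, one_div]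
    rw [mul_comm]
    exact mul_le_mul_of_nonneg_left (by linarith) this.le
  | succ n ih =>
    intro b A x M G hb hA hx hM hd hc hG hGM
    have hx' : 0 < |x|⁻¹ := by positivity
    have hsub : uIcc |x|⁻¹ M ⊆ Ioi 0 := by
      rw [uIcc_of_le hM]; exact fun t ht => hx'.trans_le ht.1
    have hxc : Complex.I * (x : ℂ) ≠ 0 := by simp [hx]
    have hE (t : ℝ) : HasDerivAt
        (fun t : ℝ => Complex.exp (Complex.I * t * x) / (Complex.I * x))
        (Complex.exp (Complex.I * t * x)) t := by
      have h1 : HasDerivAt (fun t : ℝ => Complex.I * (t : ℂ) * x) (Complex.I * 1 * x) t :=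
        ((Complex.ofRealCLM.hasDerivAt (x := t)).const_mul Complex.I).mul_const (x : ℂ)
      have h2 := h1.cexp.div_const (Complex.I * (x : ℂ))
      rwa [mul_one, mul_div_assoc, div_self hxc, mul_one] at h2
    have hparts := intervalIntegral.integral_mul_deriv_eq_deriv_mul
      (u := G 0) (u' := G 1) (v := fun t : ℝ => Complex.exp (Complex.I * t * x) / (Complex.I * x))
      (v' := fun t : ℝ => Complex.exp (Complex.I * t * x)) (a := |x|⁻¹) (b := M)
      (fun t ht => hd 0 (Nat.succ_pos n) t (hsub ht)) (fun t _ => hE t)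
      ((hc 1 (by omega)).mono hsub).intervalIntegrable
      (Continuous.intervalIntegrable (by fun_prop) _ _)
    have hih := ih (b - 1) A x M (fun l => G (l + 1)) (by push_cast at hb; linarith) hA hx hM
      (fun l hl t ht => hd (l + 1) (by omega) t ht) (fun l hl => hc (l + 1) (by omega))
      (fun l hl t ht => by
        have := hG (l + 1) (by omega) t ht
        rwa [show b - ((l + 1 : ℕ) : ℝ) = b - 1 - l by push_cast; ring] at this)
      (fun l hl => hGM (l + 1) (by omega))
    have hrw : ∫ t in |x|⁻¹..M, Complex.exp (Complex.I * t * x) * G 0 t =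
        -(G 0 |x|⁻¹ * (Complex.exp (Complex.I * (|x|⁻¹ : ℝ) * x) / (Complex.I * x))) -
        (∫ t in |x|⁻¹..M, Complex.exp (Complex.I * t * x) * G 1 t) / (Complex.I * x) := by
      calc _ = ∫ t in |x|⁻¹..M, G 0 t * Complex.exp (Complex.I * t * x) := by
            simp only [mul_comm]
        _ = _ := by
            rw [hparts, hGM 0 (by omega), zero_mul, zero_sub, ← intervalIntegral.integral_div]
            congr 2
            ext t
            ring
    rw [hrw]
    have hI : ‖Complex.I * (x : ℂ)‖ = |x| := by simp
    have hpow : |x| ^ (-(b + 1)) = |x|⁻¹ ^ b / |x| := by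
      rw [Real.inv_rpow (abs_nonneg x), ← Real.rpow_neg (abs_nonneg x),
        ← Real.rpow_sub_one (abs_pos.2 hx).ne']
      congr 1; ring
    have hpow' : |x| ^ (-(b - 1 + 1)) = |x|⁻¹ ^ b := by
      rw [Real.inv_rpow (abs_nonneg x), ← Real.rpow_neg (abs_nonneg x)]
      congr 1; ring
    have hbd : ‖G 0 |x|⁻¹‖ ≤ A * |x|⁻¹ ^ b := by simpa using hG 0 (by omega) _ hx'
    rw [hpow'] at hih
    refine (norm_sub_le _ _).trans ?_
    rw [norm_neg, norm_mul, norm_div, hexp, norm_div, hI, hpow, mul_one_div, ← add_div,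
      mul_div_assoc']
    gcongr
    push_cast
    rw [show (n : ℝ) - (b - 1 + 1) = n + 1 - (b + 1) by ring] at hih
    linear_combination hbd + hih

/-- A symbol of order `b` times a smooth function with bounded derivatives is a symbol of
order `b`. -/
lemma norm_iteratedDerivWithin_smul_le_of_symbol_bound {χ : ℝ → ℝ} {f : ℝ → ℂ} {k : ℕ}
    {b A B R t : ℝ} (hχ : ContDiff ℝ k χ) (hf : ContDiffOn ℝ k f (Ioi 0)) (hB : 0 ≤ B)
    (hA : 0 ≤ A) (hR : 1 ≤ R) (ht : 0 < t) (htR : t ≤ R)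
    (hχB : ∀ l ≤ k, ‖iteratedDerivWithin l χ (Ioi 0) t‖ ≤ B)
    (hfA : ∀ l ≤ k, ‖iteratedDerivWithin l f (Ioi 0) t‖ ≤ A * t ^ (b - l)) {l : ℕ} (hl : l ≤ k) :
    ‖iteratedDerivWithin l (fun s => χ s • f s) (Ioi 0) t‖ ≤
      2 ^ k * B * R ^ k * A * t ^ (b - l) := by
  rw [← norm_iteratedFDerivWithin_eq_norm_iteratedDerivWithin]
  refine (norm_iteratedFDerivWithin_smul_le hχ.contDiffOn hf isOpen_Ioi.uniqueDiffOn ht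
    (by exact_mod_cast hl)).trans ?_
  have hterm : ∀ i ∈ Finset.range (l + 1), (l.choose i : ℝ) *
      ‖iteratedFDerivWithin ℝ i χ (Ioi 0) t‖ * ‖iteratedFDerivWithin ℝ (l - i) f (Ioi 0) t‖ ≤
      (l.choose i : ℝ) * (B * R ^ k * A * t ^ (b - l)) := by
    intro i hi
    have hil : i ≤ l := Nat.lt_succ_iff.1 (Finset.mem_range.1 hi)
    rw [norm_iteratedFDerivWithin_eq_norm_iteratedDerivWithin,
      norm_iteratedFDerivWithin_eq_norm_iteratedDerivWithin, mul_assoc]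
    have h1 := hχB i (hil.trans hl)
    have h2 := hfA (l - i) ((Nat.sub_le _ _).trans hl)
    have h3 : t ^ (b - (l - i : ℕ)) ≤ R ^ k * t ^ (b - l) := by
      rw [Nat.cast_sub hil, show b - ((l : ℝ) - i) = i + (b - l) by ring, Real.rpow_add ht,
        Real.rpow_natCast]
      gcongr
      calc t ^ i ≤ R ^ i := by gcongr
        _ ≤ R ^ k := pow_le_pow_right₀ hR (hil.trans hl)
    refine mul_le_mul_of_nonneg_left ?_ (Nat.cast_nonneg _)
    calc _ ≤ B * (A * (R ^ k * t ^ (b - l))) :=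
          mul_le_mul h1 (h2.trans (mul_le_mul_of_nonneg_left h3 hA)) (norm_nonneg _) hB
      _ = _ := by ring
  refine (Finset.sum_le_sum hterm).trans ?_
  rw [← Finset.sum_mul]
  have hsum : (∑ i ∈ Finset.range (l + 1), (l.choose i : ℝ)) = 2 ^ l := by
    exact_mod_cast Nat.sum_range_choose l
  rw [hsum]
  have : (2 : ℝ) ^ l ≤ 2 ^ k := pow_le_pow_right₀ one_le_two hl
  have h0 : 0 ≤ B * R ^ k * A * t ^ (b - l) := by positivity
  linear_combination mul_le_mul_of_nonneg_right this h0

lemma exists_norm_iteratedDerivWithin_le {χ : ℝ → ℝ} (k : ℕ) (hχ : ContDiff ℝ k χ) (a : ℝ) :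
    ∃ B : ℝ, 0 < B ∧ ∀ l ≤ k, ∀ t, 0 < t → t ≤ a →
      ‖iteratedDerivWithin l χ (Ioi 0) t‖ ≤ B := by
  have hl (l : ℕ) : ∃ B : ℝ, l ≤ k → ∀ t ∈ Icc 0 a, ‖iteratedDeriv l χ t‖ ≤ B := by
    by_cases h : l ≤ k
    · obtain ⟨B, hB⟩ := isCompact_Icc.exists_bound_of_continuousOn
        (hχ.continuous_iteratedDeriv l (by exact_mod_cast h)).continuousOn (s := Icc 0 a)
      exact ⟨B, fun _ => hB⟩
    · exact ⟨0, fun h' => absurd h' h⟩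
  choose B hB using hl
  refine ⟨1 + ∑ i ∈ Finset.range (k + 1), |B i|, by positivity, fun l h t ht hta => ?_⟩
  rw [iteratedDerivWithin_of_isOpen isOpen_Ioi ht]
  have := Finset.single_le_sum (f := fun i => |B i|) (fun i _ => abs_nonneg _)
    (Finset.mem_range.2 (Nat.lt_succ_of_le h))
  linarith [hB l h t ⟨ht.le, hta⟩, le_abs_self (B l)]

/-- A continuous function on `(0, ∞)` that is `O(t ^ b)` with `b > -1` is integrable on bounded
intervals `(0, c]`, with the expected bound. -/
lemma intervalIntegrable_and_norm_integral_le_of_rpow_bound {h : ℝ → ℂ} {b D c : ℝ} (hb : -1 < b)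
    (hc : 0 ≤ c) (hh : ContinuousOn h (Ioi 0)) (hD : ∀ t > 0, ‖h t‖ ≤ D * t ^ b) :
    IntervalIntegrable h volume 0 c ∧ ‖∫ t in 0..c, h t‖ ≤ D * (c ^ (b + 1) / (b + 1)) := by
  have hint : IntervalIntegrable (fun t : ℝ => D * t ^ b) volume 0 c :=
    (intervalIntegral.intervalIntegrable_rpow' hb).const_mul D
  constructor
  · rw [intervalIntegrable_iff_integrableOn_Ioc_of_le hc] at hint ⊢
    refine hint.mono' ((hh.mono fun t ht => ht.1).aestronglyMeasurable measurableSet_Ioc) ?_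
    exact (ae_restrict_iff' measurableSet_Ioc).2 (ae_of_all _ fun t ht => hD t ht.1)
  · refine (intervalIntegral.norm_integral_le_of_norm_le hc
      (ae_of_all _ fun t ht => hD t ht.1) hint).trans_eq ?_
    rw [intervalIntegral.integral_const_mul, integral_rpow (Or.inl hb),
      Real.zero_rpow (by linarith), sub_zero]

lemma integrableOn_Ioi_and_integral_eq_of_eq_zero {h : ℝ → ℂ} {a c : ℝ} (hac : a ≤ c)
    (h0 : ∀ t, c < t → h t = 0) (hi : IntervalIntegrable h volume a c) :
    IntegrableOn h (Ioi a) ∧ ∫ t in Ioi a, h t = ∫ t in a..c, h t := by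
  rw [intervalIntegrable_iff_integrableOn_Ioc_of_le hac] at hi
  have hz : IntegrableOn h (Ioi c) :=
    integrableOn_zero.congr_fun (fun t ht => (h0 t ht).symm) measurableSet_Ioi
  refine ⟨by rw [← Ioc_union_Ioi_eq_Ioi hac]; exact hi.union hz, ?_⟩
  rw [intervalIntegral.integral_of_le hac]
  exact setIntegral_eq_of_subset_of_forall_sdiff_eq_zero measurableSet_Ioi Ioc_subset_Ioi_self
    fun t ht => h0 t (not_le.1 fun hle => ht.2 ⟨ht.1, hle⟩)

lemma le_mul_sqrt_one_add_sq_rpow_neg {y P Q x s : ℝ} (hs : 0 ≤ s) (hP : 0 ≤ P) (hQ : 0 ≤ Q)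
    (h1 : y ≤ P) (h2 : x ≠ 0 → y ≤ Q * |x| ^ (-s)) :
    y ≤ 2 ^ s * (P + Q) * √(1 + x ^ 2) ^ (-s) := by
  have hpos : 0 < √(1 + x ^ 2) := Real.sqrt_pos.2 (by positivity)
  have key (m : ℝ) (hm : 0 < m) (hle : √(1 + x ^ 2) ≤ 2 * m) :
      m ^ (-s) ≤ 2 ^ s * √(1 + x ^ 2) ^ (-s) := by
    have h := Real.rpow_le_rpow_of_nonpos hpos hle (neg_nonpos.2 hs)
    rw [Real.mul_rpow zero_le_two hm.le, Real.rpow_neg zero_le_two] at h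
    have h2s : (0 : ℝ) < 2 ^ s := by positivity
    calc m ^ (-s) = 2 ^ s * ((2 ^ s)⁻¹ * m ^ (-s)) := by field_simp
      _ ≤ _ := by gcongr
  have hrs : 0 ≤ 2 ^ s * √(1 + x ^ 2) ^ (-s) := by positivity
  rcases le_total |x| 1 with hx | hx
  · have hsq : x ^ 2 ≤ 1 := (sq_le_one_iff_abs_le_one x).2 hx
    have := key 1 one_pos (Real.sqrt_le_iff.2 ⟨by norm_num, by linarith⟩)
    rw [Real.one_rpow] at this
    nlinarith [mul_le_mul_of_nonneg_left this hP, mul_nonneg hQ hrs]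
  · have hx0 : x ≠ 0 := fun h => by norm_num [h] at hx
    have hsq : 1 ≤ x ^ 2 := (one_le_sq_iff_one_le_abs x).2 hx
    have := key |x| (by positivity)
      (Real.sqrt_le_iff.2 ⟨by positivity, by rw [mul_pow, sq_abs]; linarith⟩)
    nlinarith [mul_le_mul_of_nonneg_left this hQ, mul_nonneg hP hrs, h2 hx0]



/-- Oscillatory integral estimate: if `|f^{(l)}(λ)| ≤ A λ^{b-l}` on `(0, λ₀]` for
`0 ≤ l ≤ k`, with `b > -1` and `k > b + 1`, then `∫₀^∞ e^{iλx} f(λ) χ(λ) dλ` converges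
absolutely and is bounded by `C A ⟨x⟩^{-(b+1)}`, with `C = C(b,k,χ)`. -/
theorem oscillatory_integral_low_energy
    (lam0 : ℝ) (hlam0 : 0 < lam0) (χ : ℝ → ℝ)
    (hχ : ∀ k : ℕ, ContDiff ℝ k χ)
    (hχ1 : ∀ t : ℝ, |t| ≤ lam0 / 2 → χ t = 1)
    (hχ0 : ∀ t : ℝ, lam0 ≤ |t| → χ t = 0)
    (b : ℝ) (hb : -1 < b) (k : ℕ) (hk : b + 1 < (k : ℝ)) :
    ∃ C : ℝ, 0 < C ∧
      ∀ (f : ℝ → ℂ) (A : ℝ), 0 < A →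
        ContDiffOn ℝ k f (Set.Ioi 0) →
        (∀ l : ℕ, l ≤ k → ∀ lam : ℝ, 0 < lam → lam ≤ lam0 →
          ‖iteratedDerivWithin l f (Set.Ioi 0) lam‖ ≤ A * lam ^ (b - l)) →
        ∀ x : ℝ,
          IntegrableOn
            (fun lam : ℝ => Complex.exp (Complex.I * (lam : ℂ) * (x : ℂ)) * f lam *
              ((χ lam : ℝ) : ℂ)) (Set.Ioi 0) volume ∧
          ‖∫ lam in Set.Ioi (0 : ℝ),
              Complex.exp (Complex.I * (lam : ℂ) * (x : ℂ)) * f lam * ((χ lam : ℝ) : ℂ)‖ ≤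
            C * A * Real.sqrt (1 + x ^ 2) ^ (-(b + 1)) := by
  obtain ⟨B, hB0, hB⟩ := exists_norm_iteratedDerivWithin_le k (hχ k) lam0
  set K : ℝ := 2 ^ k * B * (max 1 lam0) ^ k with hK
  have hR : (0 : ℝ) < max 1 lam0 := lt_max_of_lt_left one_pos
  have hK0 : 0 < K := by positivity
  have hb1 : 0 < b + 1 := by linarith
  have hkb : 0 < (k : ℝ) - (b + 1) := by linarith
  set P : ℝ := lam0 ^ (b + 1) / (b + 1) with hP
  set Q : ℝ := 1 / (b + 1) + (k + 1 / (k - (b + 1))) with hQ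
  have hP0 : 0 < P := by positivity
  have hQ0 : 0 < Q := by positivity
  refine ⟨2 ^ (b + 1) * (K * P + K * Q), by positivity, fun f A hA hf hfA x => ?_⟩
  set G : ℕ → ℝ → ℂ := fun l => iteratedDerivWithin l (fun s => χ s • f s) (Ioi 0) with hG
  have hg : ContDiffOn ℝ k (fun s => χ s • f s) (Ioi 0) := (hχ k).contDiffOn.smul hf
  have hGc : ∀ l ≤ k, ContinuousOn (G l) (Ioi 0) := fun l hl =>
    hg.continuousOn_iteratedDerivWithin (by exact_mod_cast hl) isOpen_Ioi.uniqueDiffOn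
  have hGd : ∀ l < k, ∀ t > 0, HasDerivAt (G l) (G (l + 1) t) t := fun l hl t ht => by
    have h := (hg.differentiableOn_iteratedDerivWithin (by exact_mod_cast hl)
      isOpen_Ioi.uniqueDiffOn t ht).hasDerivWithinAt
    rw [← iteratedDerivWithin_succ] at h
    exact h.hasDerivAt (Ioi_mem_nhds ht)
  have hGz : ∀ l, ∀ t, lam0 < t → G l t = 0 := fun l t ht => by
    have hev : (fun s => χ s • f s) =ᶠ[nhds t] fun _ => 0 := by
      filter_upwards [Ioi_mem_nhds ht] with s hs
      rw [hχ0 s (hs.le.trans (le_abs_self s)), zero_smul]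
    rw [hG]
    simp only
    rw [(hev.filter_mono nhdsWithin_le_nhds).iteratedDerivWithin_eq hev.eq_of_nhds,
      iteratedDerivWithin_fun_const_zero]
  have hGb : ∀ l ≤ k, ∀ t > 0, ‖G l t‖ ≤ K * A * t ^ (b - l) := fun l hl t ht => by
    rcases le_or_gt t lam0 with h | h
    · exact norm_iteratedDerivWithin_smul_le_of_symbol_bound (hχ k) hf hB0.le hA.le
        (le_max_left _ _) ht (h.trans (le_max_right _ _)) (fun l hl => hB l hl t ht h)
        (fun l hl => hfA l hl t ht h) hl
    · rw [hGz l t h, norm_zero]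
      positivity
  set h : ℝ → ℂ := fun t => Complex.exp (Complex.I * t * x) * G 0 t with hh
  have hfun : (fun lam : ℝ => Complex.exp (Complex.I * (lam : ℂ) * (x : ℂ)) * f lam *
      ((χ lam : ℝ) : ℂ)) = h := by
    ext t
    simp only [hh, hG, iteratedDerivWithin_zero, Complex.real_smul]
    ring
  have hhc : ContinuousOn h (Ioi 0) :=
    (Continuous.continuousOn (by fun_prop)).mul (hGc 0 (Nat.zero_le k))
  have hhb : ∀ t > 0, ‖h t‖ ≤ K * A * t ^ b := fun t ht => by
    have hexp : ‖Complex.exp (Complex.I * t * x)‖ = 1 := by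
      rw [show Complex.I * t * x = ((t * x : ℝ) : ℂ) * Complex.I by push_cast; ring]
      exact Complex.norm_exp_ofReal_mul_I _
    rw [hh]
    simp only
    rw [norm_mul, hexp, one_mul]
    simpa using hGb 0 (Nat.zero_le k) t ht
  have hhz : ∀ t, lam0 < t → h t = 0 := fun t ht => by
    simp only [hh, hGz 0 t ht, mul_zero]
  obtain ⟨hi, hle⟩ := intervalIntegrable_and_norm_integral_le_of_rpow_bound hb hlam0.le hhc hhb
  obtain ⟨hion, heq⟩ := integrableOn_Ioi_and_integral_eq_of_eq_zero hlam0.le hhz hi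
  rw [hfun]
  refine ⟨hion, ?_⟩
  rw [show 2 ^ (b + 1) * (K * P + K * Q) * A = 2 ^ (b + 1) * (K * A * P + K * A * Q) by ring]
  refine le_mul_sqrt_one_add_sq_rpow_neg hb1.le (by positivity) (by positivity)
    (heq ▸ hle) fun hx => ?_
  have hx' : 0 < |x|⁻¹ := by positivity
  have hM : |x|⁻¹ ≤ max (lam0 + 1) |x|⁻¹ := le_max_right _ _
  have hlM : lam0 < max (lam0 + 1) |x|⁻¹ := lt_max_of_lt_left (by linarith)
  have hiM := (intervalIntegrable_and_norm_integral_le_of_rpow_bound hb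
    (hx'.le.trans hM) hhc hhb).1
  obtain ⟨hiε, hleε⟩ := intervalIntegrable_and_norm_integral_le_of_rpow_bound hb hx'.le hhc hhb
  have hfar := norm_integral_exp_mul_le_of_symbol_bound k b (K * A) x _ G hk (by positivity) hx hM
    hGd hGc hGb fun l _ => hGz l _ hlM
  rw [(integrableOn_Ioi_and_integral_eq_of_eq_zero (hx'.le.trans hM)
    (fun t ht => hhz t (hlM.trans ht)) hiM).2,
    ← intervalIntegral.integral_add_adjacent_intervals hiε (hiε.symm.trans hiM)]
  rw [Real.inv_rpow (abs_nonneg x), ← Real.rpow_neg (abs_nonneg x)] at hleε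
  refine (norm_add_le _ _).trans ?_
  rw [hQ]
  linear_combination hleε + hfar
end

section
/- Let λ₀ > 0, let χ be a smooth cutoff on ℝ with χ(λ) = 1 for |λ| ≤ λ₀/2 and χ(λ) = 0 for |λ| ≥ λ₀, and let φ₀ be a smooth function on ℝ with φ₀(z) = 1 for |z| ≤ 1/2 and φ₀(z) = 0 for |z| ≥ 1. Let b ≤ −1 be real. For every integer N ≥ 1 there exists a constant C_N, depending only on b, N, χ and φ₀, such that for all L ≥ 1 and all x ∈ ℝ with x ≠ 0: |∫₀^∞ e^{iλx} λ^b (1−χ(λ)) φ₀(λ/L) dλ| ≤ C_N min{1 + |log|x||, |x|^{−N}}. -/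
open MeasureTheory

open scoped ContDiff

/-- Integration by parts against the primitive `e^{iλx} - c` of `i x e^{iλx}`. -/
lemma integral_exp_sub_const_mul_deriv {f : ℝ → ℝ} (hf : ContDiff ℝ 1 f)
    (hs : HasCompactSupport f) (c : ℂ) (x : ℝ) :
    ∫ t : ℝ, (Complex.exp (Complex.I * (t : ℂ) * (x : ℂ)) - c) * ((deriv f t : ℝ) : ℂ) =
      -(Complex.I * (x : ℂ) *
        ∫ t : ℝ, Complex.exp (Complex.I * (t : ℂ) * (x : ℂ)) * (f t : ℂ)) := by
  have hfc : Continuous fun t => (f t : ℂ) := Complex.continuous_ofReal.comp hf.continuous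
  have hdc : Continuous fun t => ((deriv f t : ℝ) : ℂ) :=
    Complex.continuous_ofReal.comp (hf.continuous_deriv le_rfl)
  have hfs : HasCompactSupport fun t => (f t : ℂ) := hs.comp_left Complex.ofReal_zero
  have hds : HasCompactSupport fun t => ((deriv f t : ℝ) : ℂ) :=
    hs.deriv.comp_left Complex.ofReal_zero
  have hu : ∀ t : ℝ, HasDerivAt
      (fun t : ℝ => Complex.exp (Complex.I * (t : ℂ) * (x : ℂ)) - c)
      (Complex.exp (Complex.I * (t : ℂ) * (x : ℂ)) * (Complex.I * (x : ℂ))) t := by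
    intro t
    have h : HasDerivAt (fun t : ℝ => Complex.I * (t : ℂ) * (x : ℂ)) (Complex.I * (x : ℂ)) t := by
      simpa using ((Complex.ofRealCLM.hasDerivAt (x := t)).const_mul Complex.I).mul_const (x : ℂ)
    exact h.cexp.sub_const c
  have hv : ∀ t : ℝ, HasDerivAt (fun t => (f t : ℂ)) ((deriv f t : ℝ) : ℂ) t := fun t =>
    ((hf.differentiable one_ne_zero t).hasDerivAt).ofReal_comp
  have key := integral_mul_deriv_eq_deriv_mul_of_integrable
    (fun t _ => hu t) (fun t _ => hv t)
    (Continuous.integrable_of_hasCompactSupport (by fun_prop) hds.mul_left)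
    (Continuous.integrable_of_hasCompactSupport (by fun_prop) hfs.mul_left)
    (Continuous.integrable_of_hasCompactSupport (by fun_prop) hfs.mul_left)
  rw [key, ← integral_const_mul]
  congr 2
  ext t
  ring

lemma HasCompactSupport.iteratedDeriv' {f : ℝ → ℝ} (hs : HasCompactSupport f) (n : ℕ) :
    HasCompactSupport (iteratedDeriv n f) := by
  induction n with
  | zero => simpa using hs
  | succ n ih => rw [iteratedDeriv_succ]; exact ih.deriv

lemma integral_exp_mul_iteratedDeriv {f : ℝ → ℝ} (hf : ContDiff ℝ ∞ f)
    (hs : HasCompactSupport f) (n : ℕ) (x : ℝ) :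
    ∫ t : ℝ, Complex.exp (Complex.I * (t : ℂ) * (x : ℂ)) * ((iteratedDeriv n f t : ℝ) : ℂ) =
      (-(Complex.I * (x : ℂ))) ^ n *
        ∫ t : ℝ, Complex.exp (Complex.I * (t : ℂ) * (x : ℂ)) * (f t : ℂ) := by
  induction n with
  | zero => simp
  | succ n ih =>
    have h1 : ContDiff ℝ 1 (iteratedDeriv n f) := by
      rw [iteratedDeriv_eq_iterate]
      exact (contDiff_infty.1 hf (1 + n)).iterate_deriv' 1 n
    have h := integral_exp_sub_const_mul_deriv h1 (hs.iteratedDeriv' n) 0 x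
    simp only [sub_zero] at h
    rw [iteratedDeriv_succ, h, ih]
    ring

lemma norm_exp_I_mul_mul (t x : ℝ) :
    ‖Complex.exp (Complex.I * (t : ℂ) * (x : ℂ))‖ = 1 := by
  rw [mul_assoc, ← Complex.ofReal_mul, Complex.norm_exp_I_mul_ofReal]

/-- Rapid decay from an integrable bound on the `n`-th derivative. -/
lemma abs_pow_mul_norm_integral_exp_mul_le {f : ℝ → ℝ} (hf : ContDiff ℝ ∞ f)
    (hs : HasCompactSupport f) {n : ℕ} (hn : 1 ≤ n) {a C : ℝ} (ha : 0 < a)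
    (hzero : ∀ t ≤ a, iteratedDeriv n f t = 0)
    (hC : ∀ t, |t| ^ (n + 1) * |iteratedDeriv n f t| ≤ C) (x : ℝ) :
    |x| ^ n * ‖∫ t : ℝ, Complex.exp (Complex.I * (t : ℂ) * (x : ℂ)) * (f t : ℂ)‖ ≤
      C * ∫ t in Set.Ioi a, t ^ (-((n : ℝ) + 1)) := by
  have hn' : (1 : ℝ) ≤ n := by exact_mod_cast hn
  have hint := integrableOn_Ioi_rpow_of_lt (a := -((n : ℝ) + 1)) (by linarith) ha
  have h := integral_exp_mul_iteratedDeriv hf hs n x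
  have h2 := congrArg norm h
  rw [norm_mul, norm_pow, norm_neg, norm_mul, Complex.norm_I, one_mul, Complex.norm_real,
    Real.norm_eq_abs] at h2
  rw [← h2, ← integral_const_mul]
  rw [← setIntegral_eq_integral_of_forall_compl_eq_zero (s := Set.Ioi a)]
  · refine norm_integral_le_of_norm_le (hint.const_mul C) ?_
    refine (ae_restrict_iff' measurableSet_Ioi).2 (Filter.Eventually.of_forall fun t ht => ?_)
    have ht0 : 0 < t := ha.trans ht
    rw [norm_mul, norm_exp_I_mul_mul, one_mul, Complex.norm_real, Real.norm_eq_abs,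
      Real.rpow_neg ht0.le, ← div_eq_mul_inv, le_div_iff₀ (Real.rpow_pos_of_pos ht0 _), mul_comm]
    have := hC t
    rw [abs_of_pos ht0] at this
    exact_mod_cast this
  · intro t ht
    rw [hzero t (by simpa using ht)]
    simp

/-- Logarithmic bound near the origin for symbols of order `-1`. -/
lemma norm_integral_exp_mul_le_log {f : ℝ → ℝ} (hf : ContDiff ℝ 1 f)
    (hs : HasCompactSupport f) {a C : ℝ} (ha : 0 < a) (ha1 : a ≤ 1)
    (hzero : ∀ t ≤ a, deriv f t = 0) (hC : ∀ t, |t| ^ 2 * |deriv f t| ≤ C)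
    {x : ℝ} (hx : x ≠ 0) (hx1 : |x| < 1) :
    ‖∫ t : ℝ, Complex.exp (Complex.I * (t : ℂ) * (x : ℂ)) * (f t : ℂ)‖ ≤
      C * (|Real.log (abs x)| - Real.log a + 2) := by
  have hx0 : 0 < |x| := abs_pos.2 hx
  have hR : 1 < |x|⁻¹ := (one_lt_inv₀ hx0).2 hx1
  have haR : a ≤ |x|⁻¹ := ha1.trans hR.le
  have hR0 : 0 < |x|⁻¹ := by positivity
  set F : ℝ → ℂ := fun t =>
    (Complex.exp (Complex.I * (t : ℂ) * (x : ℂ)) - 1) * ((deriv f t : ℝ) : ℂ) with hF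
  have hbound : ∀ t, 0 < t → |deriv f t| ≤ C / t ^ 2 := fun t ht => by
    rw [le_div_iff₀ (by positivity), mul_comm]
    simpa using hC t
  have hdc : Continuous fun t => ((deriv f t : ℝ) : ℂ) :=
    Complex.continuous_ofReal.comp (hf.continuous_deriv le_rfl)
  have hFint : Integrable F := Continuous.integrable_of_hasCompactSupport (by fun_prop)
    (HasCompactSupport.mul_left (hs.deriv.comp_left Complex.ofReal_zero))
  have h := congrArg norm (integral_exp_sub_const_mul_deriv hf hs 1 x)
  rw [norm_neg, norm_mul, norm_mul, Complex.norm_I, one_mul, Complex.norm_real,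
    Real.norm_eq_abs] at h
  have hsplit : ∫ t, F t = (∫ t in a..|x|⁻¹, F t) + ∫ t in Set.Ioi |x|⁻¹, F t := by
    rw [intervalIntegral.integral_interval_add_Ioi hFint.integrableOn hFint.integrableOn]
    refine (setIntegral_eq_integral_of_forall_compl_eq_zero fun t ht => ?_).symm
    simp [hF, hzero t (by simpa using ht)]
  have hlow : ‖∫ t in a..|x|⁻¹, F t‖ ≤ |x| * (C * (|Real.log (abs x)| - Real.log a)) := by
    have hlog : ∫ t in a..|x|⁻¹, |x| * (C * t⁻¹) = |x| * (C * (|Real.log (abs x)| - Real.log a)) := by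
      rw [intervalIntegral.integral_const_mul, intervalIntegral.integral_const_mul,
        integral_inv_of_pos ha hR0, Real.log_div hR0.ne' ha.ne', Real.log_inv,
        abs_of_neg (Real.log_neg hx0 hx1)]
    rw [← hlog]
    refine intervalIntegral.norm_integral_le_of_norm_le haR
      (Filter.Eventually.of_forall fun t ht => ?_) ?_
    · have ht0 : 0 < t := ha.trans ht.1
      have h1 : ‖Complex.exp (Complex.I * (t : ℂ) * (x : ℂ)) - 1‖ ≤ t * |x| := by
        have := Real.norm_exp_I_mul_ofReal_sub_one_le (x := t * x)
        rw [Complex.ofReal_mul, ← mul_assoc, Real.norm_eq_abs, abs_mul, abs_of_pos ht0] at this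
        exact this
      calc ‖F t‖ = ‖Complex.exp (Complex.I * (t : ℂ) * (x : ℂ)) - 1‖ * |deriv f t| := by
            rw [hF, norm_mul, Complex.norm_real, Real.norm_eq_abs]
        _ ≤ (t * |x|) * (C / t ^ 2) := by
            gcongr
            exact hbound t ht0
        _ = |x| * (C * t⁻¹) := by field_simp
    · refine ContinuousOn.intervalIntegrable fun t ht => ?_
      rw [Set.uIcc_of_le haR] at ht
      have : t ≠ 0 := (ha.trans_le ht.1).ne'
      exact ContinuousAt.continuousWithinAt (by fun_prop (disch := assumption))
  have hhigh : ‖∫ t in Set.Ioi |x|⁻¹, F t‖ ≤ |x| * (C * 2) := by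
    have hint := integrableOn_Ioi_rpow_of_lt (a := (-2 : ℝ)) (by norm_num) hR0
    have hval : ∫ t in Set.Ioi |x|⁻¹, 2 * C * t ^ (-2 : ℝ) = |x| * (C * 2) := by
      rw [integral_const_mul, integral_Ioi_rpow_of_lt (by norm_num) hR0]
      norm_num [Real.rpow_neg_one]
      ring
    rw [← hval]
    refine norm_integral_le_of_norm_le (hint.const_mul _) ?_
    refine (ae_restrict_iff' measurableSet_Ioi).2 (Filter.Eventually.of_forall fun t ht => ?_)
    have ht0 : 0 < t := hR0.trans ht
    have h1 : ‖Complex.exp (Complex.I * (t : ℂ) * (x : ℂ)) - 1‖ ≤ 2 := by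
      refine (norm_sub_le _ _).trans ?_
      rw [norm_exp_I_mul_mul, norm_one]
      norm_num
    calc ‖F t‖ = ‖Complex.exp (Complex.I * (t : ℂ) * (x : ℂ)) - 1‖ * |deriv f t| := by
          rw [hF, norm_mul, Complex.norm_real, Real.norm_eq_abs]
      _ ≤ 2 * (C / t ^ 2) := by
          gcongr
          exact hbound t ht0
      _ = 2 * C * t ^ (-2 : ℝ) := by
          rw [Real.rpow_neg ht0.le, Real.rpow_two]
          ring
  refine le_of_mul_le_mul_left ?_ hx0
  rw [← h, hsplit]
  refine (norm_add_le _ _).trans ((add_le_add hlow hhigh).trans_eq ?_)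
  ring

/-- The profile `λ^b (1 - χ(λ))` on the positive half-line, extended by zero. -/
noncomputable def rpowHighPass (b : ℝ) (χ : ℝ → ℝ) : ℝ → ℝ :=
  (Set.Ioi (0 : ℝ)).indicator fun t => t ^ b * (1 - χ t)

lemma rpowHighPass_eq_zero {b r : ℝ} {χ : ℝ → ℝ} (hχ1 : ∀ t : ℝ, |t| ≤ r → χ t = 1)
    {t : ℝ} (ht : t ≤ r) : rpowHighPass b χ t = 0 := by
  by_cases h : 0 < t
  · simp [rpowHighPass, hχ1 t (by rwa [abs_of_pos h])]
  · simp [rpowHighPass, h]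

lemma contDiff_rpowHighPass {b r : ℝ} (hr : 0 < r) {χ : ℝ → ℝ} (hχ : ContDiff ℝ ∞ χ)
    (hχ1 : ∀ t : ℝ, |t| ≤ r → χ t = 1) : ContDiff ℝ ∞ (rpowHighPass b χ) := by
  rw [contDiff_iff_contDiffAt]
  intro t
  rcases lt_or_ge t r with h | h
  · refine (contDiffAt_const (c := (0 : ℝ))).congr_of_eventuallyEq ?_
    filter_upwards [Iio_mem_nhds h] with s hs
    exact rpowHighPass_eq_zero hχ1 (le_of_lt hs)
  · have ht : 0 < t := hr.trans_le h
    have : ContDiffAt ℝ ∞ (fun t => t ^ b * (1 - χ t)) t :=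
      (Real.contDiffAt_rpow_const_of_ne ht.ne').mul (contDiffAt_const.sub hχ.contDiffAt)
    refine this.congr_of_eventuallyEq ?_
    filter_upwards [Ioi_mem_nhds ht] with s hs
    exact Set.indicator_of_mem hs _

/-- `λ^b (1 - χ(λ))` with `b ≤ -1` satisfies symbol estimates of order `-1`. -/
lemma exists_bound_iteratedDeriv_rpowHighPass {b r R : ℝ} (hb : b ≤ -1) (hr : 0 < r)
    (hR : 0 < R) {χ : ℝ → ℝ} (hχ : ContDiff ℝ ∞ χ) (hχ1 : ∀ t : ℝ, |t| ≤ r → χ t = 1)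
    (hχ0 : ∀ t : ℝ, R ≤ |t| → χ t = 0) (k : ℕ) :
    ∃ C, ∀ t, |t| ^ (k + 1) * |iteratedDeriv k (rpowHighPass b χ) t| ≤ C := by
  have hsm := contDiff_rpowHighPass (b := b) hr hχ hχ1
  have hcont : Continuous fun t => |t| ^ (k + 1) * |iteratedDeriv k (rpowHighPass b χ) t| := by
    have := hsm.continuous_iteratedDeriv k (by exact_mod_cast le_top)
    fun_prop
  obtain ⟨C, hC⟩ := (isCompact_Icc (a := (0 : ℝ)) (b := R)).exists_bound_of_continuousOn
    hcont.continuousOn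
  refine ⟨max C (|(descPochhammer ℝ k).eval b| * R ^ (b + 1)), fun t => ?_⟩
  rcases lt_or_ge t 0 with ht | ht
  · have h0 : iteratedDeriv k (rpowHighPass b χ) t = 0 := by
      have he : rpowHighPass b χ =ᶠ[nhds t] fun _ => (0 : ℝ) := by
        filter_upwards [Iio_mem_nhds ht] with s hs
        exact rpowHighPass_eq_zero hχ1 (le_of_lt (lt_trans hs hr))
      rw [he.iteratedDeriv_eq]
      simp
    rw [h0]
    have := (norm_nonneg _).trans (hC 0 ⟨le_rfl, hR.le⟩)
    simpa using Or.inl this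
  rcases le_or_gt t R with htR | htR
  · exact ((Real.le_norm_self _).trans (hC t ⟨ht, htR⟩)).trans (le_max_left _ _)
  · have ht0 : 0 < t := hR.trans htR
    have he : rpowHighPass b χ =ᶠ[nhds t] fun s => s ^ b := by
      filter_upwards [Ioi_mem_nhds htR] with s hs
      have hs0 : 0 < s := hR.trans hs
      simp [rpowHighPass, hs0, hχ0 s (by rw [abs_of_pos hs0]; exact le_of_lt hs)]
    rw [he.iteratedDeriv_eq, iteratedDeriv_eq_iterate, Real.iter_deriv_rpow_const, abs_mul,
      abs_of_pos ht0, abs_of_pos (Real.rpow_pos_of_pos ht0 _)]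
    refine le_trans (le_of_eq ?_) (le_max_right _ _ |>.trans' <| mul_le_mul_of_nonneg_left
      (Real.rpow_le_rpow_of_nonpos hR htR.le (by linarith : b + 1 ≤ 0)) (abs_nonneg _))
    have : t ^ (b + 1) = t ^ (k + 1) * t ^ (b - k) := by
      rw [← Real.rpow_natCast, ← Real.rpow_add ht0]
      congr 1
      push_cast
      ring
    rw [this]
    ring

/-- Symbol estimates of order `0` for dilates of a cutoff, uniform in the dilation. -/
lemma exists_bound_iteratedDeriv_dilate {φ : ℝ → ℝ} (hφ : ContDiff ℝ ∞ φ)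
    (hs : HasCompactSupport φ) (k : ℕ) :
    ∃ C, ∀ c t : ℝ, |t| ^ k * |iteratedDeriv k (fun s => φ (c * s)) t| ≤ C := by
  have hcont : Continuous fun t => t ^ k * iteratedDeriv k φ t := by
    have := hφ.continuous_iteratedDeriv k (by exact_mod_cast le_top)
    fun_prop
  obtain ⟨C, hC⟩ := HasCompactSupport.exists_bound_of_continuous
    ((hs.iteratedDeriv' k).mul_left (f := fun t => t ^ k)) hcont
  refine ⟨C, fun c t => ?_⟩
  rw [iteratedDeriv_comp_const_mul (contDiff_infty.1 hφ k)]
  refine le_trans (le_of_eq ?_) (hC (c * t))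
  simp only [Pi.mul_apply, Real.norm_eq_abs, abs_mul, abs_pow, mul_pow]
  ring

lemma exists_bound_iteratedDeriv_mul_dilate {g φ : ℝ → ℝ} (hg : ContDiff ℝ ∞ g)
    (hgb : ∀ k : ℕ, ∃ C, ∀ t, |t| ^ (k + 1) * |iteratedDeriv k g t| ≤ C)
    (hφ : ContDiff ℝ ∞ φ) (hs : HasCompactSupport φ) (n : ℕ) :
    ∃ C, ∀ c t : ℝ, |t| ^ (n + 1) * |iteratedDeriv n (fun s => g s * φ (c * s)) t| ≤ C := by
  choose A hA using hgb
  choose B hB using exists_bound_iteratedDeriv_dilate hφ hs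
  refine ⟨∑ i ∈ Finset.range (n + 1), n.choose i * A i * B (n - i), fun c t => ?_⟩
  have hd : ContDiff ℝ ∞ fun s => φ (c * s) := hφ.comp (contDiff_const.mul contDiff_id)
  rw [iteratedDeriv_fun_mul (contDiff_infty.1 hg n).contDiffAt (contDiff_infty.1 hd n).contDiffAt]
  refine (mul_le_mul_of_nonneg_left (Finset.abs_sum_le_sum_abs _ _) (by positivity)).trans ?_
  rw [Finset.mul_sum]
  refine Finset.sum_le_sum fun i hi => ?_
  have hin : i ≤ n := Nat.lt_succ_iff.1 (Finset.mem_range.1 hi)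
  calc |t| ^ (n + 1) * |n.choose i * iteratedDeriv i g t *
        iteratedDeriv (n - i) (fun s => φ (c * s)) t|
      = n.choose i * (|t| ^ (i + 1) * |iteratedDeriv i g t|) *
        (|t| ^ (n - i) * |iteratedDeriv (n - i) (fun s => φ (c * s)) t|) := by
        rw [abs_mul, abs_mul, Nat.abs_cast, show n + 1 = (i + 1) + (n - i) by omega, pow_add]
        ring
    _ ≤ n.choose i * A i * B (n - i) := by
        have h0 : 0 ≤ A i := le_trans (by positivity) (hA i 0)
        gcongr
        · exact hA i t
        · exact hB (n - i) c t

/-- High-energy oscillatory integral estimate: for `b ≤ -1` and each `N ≥ 1`,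
`|∫₀^∞ e^{iλx} λ^b (1-χ(λ)) φ₀(λ/L) dλ| ≤ C_N min{1 + |log|x||, |x|^{-N}}`,
uniformly in `L ≥ 1` and `x ≠ 0`. -/
theorem oscillatory_integral_high_energy
    (lam0 : ℝ) (hlam0 : 0 < lam0) (χ φ0 : ℝ → ℝ)
    (hχ : ∀ k : ℕ, ContDiff ℝ k χ)
    (hχ1 : ∀ t : ℝ, |t| ≤ lam0 / 2 → χ t = 1)
    (hχ0 : ∀ t : ℝ, lam0 ≤ |t| → χ t = 0)
    (hφ : ∀ k : ℕ, ContDiff ℝ k φ0)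
    (hφ1 : ∀ t : ℝ, |t| ≤ 1 / 2 → φ0 t = 1)
    (hφ0 : ∀ t : ℝ, 1 ≤ |t| → φ0 t = 0)
    (b : ℝ) (hb : b ≤ -1) :
    ∀ N : ℕ, 1 ≤ N →
      ∃ C : ℝ, 0 < C ∧
        ∀ L : ℝ, 1 ≤ L → ∀ x : ℝ, x ≠ 0 →
          ‖∫ lam in Set.Ioi (0 : ℝ),
              Complex.exp (Complex.I * (lam : ℂ) * (x : ℂ)) * ((lam ^ b : ℝ) : ℂ) *
                (((1 - χ lam) * φ0 (lam / L) : ℝ) : ℂ)‖ ≤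
            C * min (1 + |Real.log (abs x)|) ((abs x) ^ (-(N : ℝ))) := by
  intro N hN
  have hr : 0 < lam0 / 2 := by positivity
  have hφs : HasCompactSupport φ0 := HasCompactSupport.intro (isCompact_Icc (a := -1) (b := 1))
    fun t ht => hφ0 t (by
      by_contra! h
      exact ht ⟨(abs_lt.1 h).1.le, (abs_lt.1 h).2.le⟩)
  have hg := contDiff_rpowHighPass (b := b) hr (contDiff_infty.2 hχ) hχ1
  have hbd := exists_bound_iteratedDeriv_mul_dilate hg
    (exists_bound_iteratedDeriv_rpowHighPass hb hr hlam0 (contDiff_infty.2 hχ) hχ1 hχ0)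
    (contDiff_infty.2 hφ) hφs
  obtain ⟨A, hA⟩ := hbd 1
  obtain ⟨B, hB⟩ := hbd N
  set a : ℝ := min (lam0 / 4) 1
  have ha : 0 < a := by positivity
  have ha1 : a ≤ 1 := min_le_right _ _
  have hal : a < lam0 / 2 := (min_le_left _ _).trans_lt (by linarith)
  have hla : Real.log a ≤ 0 := Real.log_nonpos ha.le ha1
  have hA0 : 0 ≤ A := le_trans (by positivity) (hA 0 0)
  set D : ℝ := B * ∫ t in Set.Ioi a, t ^ (-((N : ℝ) + 1))
  set K : ℝ := A * (2 - Real.log a) with hK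
  have hK0 : 0 ≤ K := mul_nonneg hA0 (by linarith)
  have main : ∀ L : ℝ, 1 ≤ L → ∀ x : ℝ, x ≠ 0 → ∃ J : ℝ,
      ‖∫ lam in Set.Ioi (0 : ℝ),
        Complex.exp (Complex.I * (lam : ℂ) * (x : ℂ)) * ((lam ^ b : ℝ) : ℂ) *
          (((1 - χ lam) * φ0 (lam / L) : ℝ) : ℂ)‖ = J ∧
      |x| ^ N * J ≤ D ∧ (|x| < 1 → J ≤ K * (1 + |Real.log (abs x)|)) := by
    intro L hL x hx
    have hL0 : 0 < L := one_pos.trans_le hL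
    set f : ℝ → ℝ := fun s => rpowHighPass b χ s * φ0 (L⁻¹ * s) with hf_def
    have hf : ContDiff ℝ ∞ f :=
      hg.mul ((contDiff_infty.2 hφ).comp (contDiff_const.mul contDiff_id))
    have hfs : HasCompactSupport f := by
      refine HasCompactSupport.mul_left ?_
      exact hφs.comp_homeomorph (Homeomorph.mulLeft₀ L⁻¹ (inv_ne_zero hL0.ne'))
    have hzero : ∀ n : ℕ, ∀ t ≤ a, iteratedDeriv n f t = 0 := by
      intro n t ht
      have he : f =ᶠ[nhds t] fun _ => (0 : ℝ) := by
        filter_upwards [Iio_mem_nhds (ht.trans_lt hal)] with s hs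
        simp [hf_def, rpowHighPass_eq_zero hχ1 (le_of_lt hs)]
      rw [he.iteratedDeriv_eq]
      simp
    have hint : ∫ lam in Set.Ioi (0 : ℝ),
        Complex.exp (Complex.I * (lam : ℂ) * (x : ℂ)) * ((lam ^ b : ℝ) : ℂ) *
          (((1 - χ lam) * φ0 (lam / L) : ℝ) : ℂ) =
        ∫ t : ℝ, Complex.exp (Complex.I * (t : ℂ) * (x : ℂ)) * (f t : ℂ) := by
      refine Eq.trans ?_
        (setIntegral_eq_integral_of_forall_compl_eq_zero (s := Set.Ioi (0 : ℝ)) ?_)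
      · refine setIntegral_congr_fun measurableSet_Ioi fun t ht => ?_
        have : f t = t ^ b * ((1 - χ t) * φ0 (t / L)) := by
          simp only [hf_def, rpowHighPass, Set.indicator_of_mem ht, div_eq_inv_mul]
          ring
        simp only [this, Complex.ofReal_mul]
        ring
      · intro t ht
        have : f t = 0 := by
          simpa using hzero 0 t (le_trans (by simpa using ht) ha.le)
        simp [this]
    refine ⟨_, rfl, ?_, fun hx1 => ?_⟩
    · rw [hint]
      exact abs_pow_mul_norm_integral_exp_mul_le hf hfs hN ha (hzero N) (fun t => hB L⁻¹ t) x
    · rw [hint]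
      refine (norm_integral_exp_mul_le_log (contDiff_infty.1 hf 1) hfs ha ha1
        (fun t ht => by simpa [iteratedDeriv_one] using hzero 1 t ht)
        (fun t => by simpa [iteratedDeriv_one] using hA L⁻¹ t) hx hx1).trans ?_
      rw [hK, mul_assoc]
      refine mul_le_mul_of_nonneg_left ?_ hA0
      nlinarith [abs_nonneg (Real.log |x|)]
  have hD0 : 0 ≤ D := by
    obtain ⟨J, hJ, h1, -⟩ := main 1 le_rfl 1 one_ne_zero
    exact le_trans (mul_nonneg (by positivity) (hJ ▸ norm_nonneg _)) h1
  refine ⟨D + K + 1, by positivity, fun L hL x hx => ?_⟩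
  obtain ⟨J, hJ, h1, h2⟩ := main L hL x hx
  have hx0 : 0 < |x| := abs_pos.2 hx
  have hJ0 : 0 ≤ J := hJ ▸ norm_nonneg _
  have hl := abs_nonneg (Real.log |x|)
  rw [hJ, mul_min_of_nonneg _ _ (by positivity)]
  refine le_min ?_ ?_
  · rcases lt_or_ge |x| 1 with hx1 | hx1
    · exact (h2 hx1).trans (by gcongr; linarith)
    · have h3 : J ≤ |x| ^ N * J := le_mul_of_one_le_left hJ0 (one_le_pow₀ hx1)
      nlinarith
  · rw [Real.rpow_neg hx0.le, Real.rpow_natCast, ← div_eq_mul_inv,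
      le_div_iff₀ (by positivity), mul_comm]
    linarith
end

section
/- Let n ≥ 1 be an integer, ϑ ∈ ℕ₀, and l ∈ ℤ with l ≥ (1−n)/2. Let v : ℝⁿ → [0,∞) be measurable with v(x) ≤ C₀⟨x⟩^{−σ} for some σ > max{ϑ, l} + n/2 and C₀ > 0. Let Q be an orthogonal projection on L²(ℝⁿ) (bounded, self-adjoint, idempotent) such that Q(x^α v) = 0 for every multi-index α with |α| ≤ ϑ−1 (a vacuous condition if ϑ = 0). Then there is a constant C, depending only on n, ϑ, l, σ, C₀, such that for all y ∈ ℝⁿ: ‖Q(v(·)|· − y|^l)‖_{L²(ℝⁿ)} ≤ C ⟨y⟩^{l−ϑ}. -/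
open MeasureTheory
open scoped ENNReal ComplexInnerProductSpace

/-- The Japanese bracket `⟨x⟩ = (1 + ‖x‖²)^{1/2}`. -/
noncomputable def japaneseBracket {E : Type*} [Norm E] (x : E) : ℝ := Real.sqrt (1 + ‖x‖ ^ 2)

section JapaneseBracket

variable {E : Type*} [NormedAddCommGroup E]

lemma one_le_japaneseBracket (x : E) : 1 ≤ japaneseBracket x :=
  Real.one_le_sqrt.2 (by nlinarith [sq_nonneg ‖x‖])

lemma japaneseBracket_pos (x : E) : 0 < japaneseBracket x :=
  one_pos.trans_le (one_le_japaneseBracket x)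

lemma norm_le_japaneseBracket (x : E) : ‖x‖ ≤ japaneseBracket x :=
  Real.le_sqrt_of_sq_le (by linarith)

lemma japaneseBracket_le_one_add_norm (x : E) : japaneseBracket x ≤ 1 + ‖x‖ :=
  Real.sqrt_le_iff.2 ⟨by positivity, by nlinarith [norm_nonneg x]⟩

lemma japaneseBracket_sub_le (x y : E) :
    japaneseBracket (x - y) ≤ japaneseBracket x + japaneseBracket y := by
  have hx := japaneseBracket_pos x
  have hy := japaneseBracket_pos y
  refine Real.sqrt_le_iff.2 ⟨by positivity, ?_⟩
  have h1 : japaneseBracket x ^ 2 = 1 + ‖x‖ ^ 2 := Real.sq_sqrt (by positivity)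
  have h2 : japaneseBracket y ^ 2 = 1 + ‖y‖ ^ 2 := Real.sq_sqrt (by positivity)
  have h3 : ‖x - y‖ ^ 2 ≤ (‖x‖ + ‖y‖) ^ 2 := by gcongr; exact norm_sub_le x y
  have h4 : ‖x‖ * ‖y‖ ≤ japaneseBracket x * japaneseBracket y := by
    gcongr <;> exact norm_le_japaneseBracket _
  nlinarith

end JapaneseBracket

lemma memLp_japaneseBracket {E : Type*} [NormedAddCommGroup E] [NormedSpace ℝ E] [FiniteDimensional ℝ E]
    [MeasurableSpace E] [BorelSpace E] {μ : Measure E} [μ.IsAddHaarMeasure] {s : ℝ}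
    (hs : (Module.finrank ℝ E : ℝ) / 2 < s) :
    MemLp (fun x : E => japaneseBracket x ^ (-s)) 2 μ := by
  have hm : Measurable (fun x : E => Real.sqrt (1 + ‖x‖ ^ 2) ^ (-s)) := by fun_prop
  refine (memLp_two_iff_integrable_sq hm.aestronglyMeasurable).2 ?_
  convert integrable_rpow_neg_one_add_norm_sq (E := E) (μ := μ) (r := 2 * s) (by linarith) using 2 with x
  rw [Real.sqrt_eq_rpow, ← Real.rpow_natCast, ← Real.rpow_mul (by positivity),
    ← Real.rpow_mul (by positivity)]
  congr 1; push_cast; ring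

lemma memLp_norm_zpow_mul_japaneseBracket {E : Type*} [NormedAddCommGroup E] [NormedSpace ℝ E] [FiniteDimensional ℝ E]
    [Nontrivial E]
    [MeasurableSpace E] [BorelSpace E] {μ : Measure E} [μ.IsAddHaarMeasure] {s : ℝ} {l : ℤ}
    (hs : (Module.finrank ℝ E : ℝ) / 2 < s) (hl : (1 : ℝ) - Module.finrank ℝ E ≤ 2 * (l : ℝ)) :
    MemLp (fun x : E => ‖x‖ ^ l * japaneseBracket x ^ (-s - l)) 2 μ := by
  have hd : 1 ≤ Module.finrank ℝ E := Module.finrank_pos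
  have hm : Measurable (fun x : E => ‖x‖ ^ l * Real.sqrt (1 + ‖x‖ ^ 2) ^ (-s - l)) := by
    fun_prop
  refine (memLp_two_iff_integrable_sq hm.aestronglyMeasurable).2 ?_
  refine (integrable_fun_norm_addHaar (E := E) μ
    (f := fun r : ℝ => (r ^ l * Real.sqrt (1 + r ^ 2) ^ (-s - l)) ^ 2)).2 ?_
  have h1 := (integrable_rpow_neg_one_add_norm_sq (E := ℝ) (μ := volume) (r := 2 * s - (Module.finrank ℝ E - 1))
    (by simp; linarith)).integrableOn (s := Set.Ioi 0)
  refine h1.mono' (by fun_prop) ?_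
  filter_upwards [ae_restrict_mem measurableSet_Ioi] with r hr
  have hr : 0 < r := hr
  generalize Module.finrank ℝ E = d at *
  have hj : 0 < 1 + r ^ 2 := by positivity
  rw [smul_eq_mul, Real.norm_of_nonneg (by positivity), Real.norm_of_nonneg hr.le, mul_pow,
    Real.sqrt_eq_rpow, ← Real.rpow_mul hj.le, ← Real.rpow_mul_natCast hj.le,
    ← Real.rpow_intCast, ← Real.rpow_mul_natCast hr.le, ← Real.rpow_natCast,
    ← mul_assoc, ← Real.rpow_add hr, Nat.cast_sub hd]
  have e1 : -(2 * s - ((d : ℝ) - 1)) / 2 = ((d : ℝ) - 1 + 2 * l) / 2 + (1 / 2) * (-s - l) * 2 := by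
    ring
  rw [e1, Real.rpow_add hj]
  push_cast
  gcongr
  have e2 : r ^ ((d : ℝ) - 1 + l * 2) = (r ^ 2) ^ (((d : ℝ) - 1 + 2 * l) / 2) := by
    rw [← Real.rpow_natCast r 2, ← Real.rpow_mul hr.le]
    congr 1; push_cast; ring
  rw [e2]
  exact Real.rpow_le_rpow (by positivity) (by linarith) (by linarith)

lemma exists_abs_one_sub_rpow_sub_sum_le (s : ℝ) (N : ℕ) : ∃ ε : ℝ, 0 < ε ∧ ε ≤ 1 ∧ ∃ K : ℝ, 0 ≤ K ∧ ∃ c : ℕ → ℝ, ∀ w : ℝ,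
    |w| ≤ ε → |(1 - w) ^ s - ∑ j ∈ Finset.range N, c j * w ^ j| ≤ K * |w| ^ N := by
  have ha : AnalyticAt ℝ (fun w : ℝ => Real.exp (s * Real.log (1 - w))) 0 := by
    have : AnalyticAt ℝ (fun w : ℝ => 1 - w) 0 := by fun_prop
    exact (analyticAt_const.mul (this.log (by simp))).rexp
  obtain ⟨p, hp⟩ := ha
  have hO := hp.isBigO_sub_partialSum_pow N
  obtain ⟨K, hK, hO⟩ := hO.exists_pos
  obtain ⟨δ, hδ, h⟩ := Metric.eventually_nhds_iff.1 hO.bound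
  refine ⟨min (δ / 2) (1 / 2), by positivity, (min_le_right _ _).trans (by norm_num), K, hK.le,
    p.coeff, fun w hw => ?_⟩
  have h1 : |w| ≤ δ / 2 := hw.trans (min_le_left _ _)
  have h2 : |w| ≤ 1 / 2 := hw.trans (min_le_right _ _)
  have h3 := h (y := w) (by simp; linarith)
  have h4 : 0 < 1 - w := by linarith [le_abs_self w]
  simp only [zero_add, FormalMultilinearSeries.partialSum,
    FormalMultilinearSeries.apply_eq_pow_smul_coeff, Real.norm_eq_abs, abs_pow, abs_abs,
    smul_eq_mul] at h3
  rw [Real.rpow_def_of_pos h4, mul_comm (Real.log _)]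
  simpa only [mul_comm (p.coeff _)] using h3

lemma norm_apply_le_of_orthogonal_projection {H : Type*} [NormedAddCommGroup H] [InnerProductSpace ℂ H] (Q : H →L[ℂ] H)
    (h1 : ∀ f, Q (Q f) = Q f) (h2 : ∀ f g, ⟪Q f, g⟫ = ⟪f, Q g⟫) (f : H) : ‖Q f‖ ≤ ‖f‖ := by
  have h : ‖Q f‖ * ‖Q f‖ ≤ ‖f‖ * ‖Q f‖ := by
    rw [← inner_self_eq_norm_mul_norm (𝕜 := ℂ), h2, h1]
    exact (RCLike.re_le_norm _).trans (norm_inner_le_norm _ _)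
  rcases (norm_nonneg (Q f)).eq_or_lt with h0 | h0
  · rw [← h0]; positivity
  · exact le_of_mul_le_mul_right h h0

lemma exists_truncated_binomial_bound (N : ℕ) (c : ℕ → ℝ) : ∃ M : ℝ, 0 ≤ M ∧ ∀ a b r : ℝ, 0 ≤ r → |a| ≤ 2 * r →
    |b| ≤ r ^ 2 →
    (r ≤ 1 → |∑ j ∈ Finset.range N, c j * (a - b) ^ j -
      ∑ j ∈ Finset.range N, ∑ m ∈ Finset.range (j + 1),
        if j + m < N then c j * ((-b) ^ m * a ^ (j - m) * (j.choose m : ℝ)) else 0|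
        ≤ M * r ^ N) ∧
    (∀ ε : ℝ, 0 < ε → ε ≤ 1 → ε ≤ r → ε ^ N * |∑ j ∈ Finset.range N, ∑ m ∈ Finset.range (j + 1),
        if j + m < N then c j * ((-b) ^ m * a ^ (j - m) * (j.choose m : ℝ)) else 0|
        ≤ M * r ^ N) := by
  refine ⟨∑ j ∈ Finset.range N, ∑ m ∈ Finset.range (j + 1), |c j| * (2 ^ j * (j.choose m : ℝ)),
    by positivity, fun a b r hr ha hb => ?_⟩
  have key : ∀ j m : ℕ, m ≤ j → |c j * ((-b) ^ m * a ^ (j - m) * (j.choose m : ℝ))| ≤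
      |c j| * (2 ^ j * (j.choose m : ℝ)) * r ^ (j + m) := by
    intro j m hm
    rw [abs_mul, abs_mul, abs_mul, abs_pow, abs_pow, abs_neg, Nat.abs_cast, mul_assoc (|c j|)]
    refine mul_le_mul_of_nonneg_left ?_ (abs_nonneg _)
    have h1 : |b| ^ m * |a| ^ (j - m) ≤ (r ^ 2) ^ m * (2 * r) ^ (j - m) := by gcongr
    have h2 : (r ^ 2) ^ m * (2 * r) ^ (j - m) = 2 ^ (j - m) * r ^ (j + m) := by
      rw [mul_pow, ← pow_mul, mul_left_comm, ← pow_add]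
      congr 2; omega
    have h3 : (2 : ℝ) ^ (j - m) ≤ 2 ^ j := pow_le_pow_right₀ (by norm_num) (by omega)
    calc |b| ^ m * |a| ^ (j - m) * (j.choose m : ℝ)
        ≤ 2 ^ (j - m) * r ^ (j + m) * (j.choose m : ℝ) := by rw [← h2]; gcongr
      _ ≤ 2 ^ j * r ^ (j + m) * (j.choose m : ℝ) := by gcongr
      _ = _ := by ring
  refine ⟨fun hr1 => ?_, fun ε hε hε1 hεr => ?_⟩
  · have e : ∀ j, c j * (a - b) ^ j = ∑ m ∈ Finset.range (j + 1),
        c j * ((-b) ^ m * a ^ (j - m) * (j.choose m : ℝ)) := by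
      intro j
      rw [← Finset.mul_sum, ← add_pow, neg_add_eq_sub]
    simp_rw [e]
    rw [← Finset.sum_sub_distrib, Finset.sum_mul]
    refine (Finset.abs_sum_le_sum_abs _ _).trans (Finset.sum_le_sum fun j hj => ?_)
    rw [← Finset.sum_sub_distrib, Finset.sum_mul]
    refine (Finset.abs_sum_le_sum_abs _ _).trans (Finset.sum_le_sum fun m hm => ?_)
    split_ifs with h
    · rw [sub_self, abs_zero]; positivity
    · rw [sub_zero]
      refine (key j m (by simp at hm; omega)).trans ?_
      exact mul_le_mul_of_nonneg_left (pow_le_pow_of_le_one hr hr1 (by omega)) (by positivity)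
  · rw [← abs_of_pos (pow_pos hε N), ← abs_mul, Finset.mul_sum, Finset.sum_mul]
    refine (Finset.abs_sum_le_sum_abs _ _).trans (Finset.sum_le_sum fun j hj => ?_)
    rw [Finset.mul_sum, Finset.sum_mul]
    refine (Finset.abs_sum_le_sum_abs _ _).trans (Finset.sum_le_sum fun m hm => ?_)
    rw [abs_mul, abs_of_pos (pow_pos hε N)]
    split_ifs with h
    · have h1 : ε ^ N * r ^ (j + m) ≤ r ^ N := by
        calc ε ^ N * r ^ (j + m) ≤ ε ^ (N - (j + m)) * r ^ (j + m) := by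
              gcongr 1
              exact pow_le_pow_of_le_one hε.le hε1 (by omega)
          _ ≤ r ^ (N - (j + m)) * r ^ (j + m) := by gcongr
          _ = r ^ N := by rw [← pow_add]; congr 1; omega
      calc _ ≤ ε ^ N * (|c j| * (2 ^ j * (j.choose m : ℝ)) * r ^ (j + m)) := by
            gcongr; exact key j m (by simp at hm; omega)
        _ = |c j| * (2 ^ j * (j.choose m : ℝ)) * (ε ^ N * r ^ (j + m)) := by ring
        _ ≤ _ := by gcongr
    · rw [abs_zero, mul_zero]; positivity

/-- Taylor approximation of `x ↦ ‖x - y‖ ^ l` by a polynomial of degree less than `N`, uniformly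
in `y`, together with a growth bound on the polynomial away from the origin. -/
lemma exists_taylor_polynomial (n N : ℕ) (l : ℤ) : ∃ ε : ℝ, 0 < ε ∧ ε ≤ 1 ∧ ∃ M : ℝ, 0 ≤ M ∧
    ∀ y : EuclideanSpace ℝ (Fin n), y ≠ 0 →
      ∃ P ∈ MvPolynomial.restrictSupport ℝ {α : Fin n →₀ ℕ | ∑ i, α i < N},
        (∀ x : EuclideanSpace ℝ (Fin n), ‖x‖ ≤ ε * ‖y‖ →
          |‖x - y‖ ^ l - MvPolynomial.eval (fun i => x i) P| ≤
            M * (‖y‖ ^ l * (‖x‖ / ‖y‖) ^ N)) ∧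
        (∀ x : EuclideanSpace ℝ (Fin n), ε * ‖y‖ ≤ ‖x‖ →
          |MvPolynomial.eval (fun i => x i) P| ≤ M * (‖y‖ ^ l * (‖x‖ / ‖y‖) ^ N)) := by
  obtain ⟨δ, hδ, hδ1, K, hK, c, hc⟩ := exists_abs_one_sub_rpow_sub_sum_le ((l : ℝ) / 2) N
  obtain ⟨M, hM, ht⟩ := exists_truncated_binomial_bound N c
  have hε : 0 < δ / 3 := by positivity
  have hε1 : δ / 3 ≤ 1 := by linarith
  refine ⟨δ / 3, hε, hε1, K * 3 ^ N + M + M / (δ / 3) ^ N, by positivity, fun y hy => ?_⟩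
  have hy0 : 0 < ‖y‖ := norm_pos_iff.2 hy
  let A : MvPolynomial (Fin n) ℝ := ∑ i, MvPolynomial.C (2 * y i / ‖y‖ ^ 2) * MvPolynomial.X i
  let B : MvPolynomial (Fin n) ℝ := ∑ i, MvPolynomial.C (-(1 / ‖y‖ ^ 2)) * MvPolynomial.X i ^ 2
  have hA : A.totalDegree ≤ 1 := by
    refine MvPolynomial.totalDegree_finsetSum_le fun i _ => ?_
    refine (MvPolynomial.totalDegree_mul _ _).trans ?_
    simp
  have hB : B.totalDegree ≤ 2 := by
    refine MvPolynomial.totalDegree_finsetSum_le fun i _ => ?_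
    refine (MvPolynomial.totalDegree_mul _ _).trans ?_
    simp
  let T : ℕ → ℕ → MvPolynomial (Fin n) ℝ := fun j m =>
    MvPolynomial.C (‖y‖ ^ l * c j * (j.choose m : ℝ)) * (B ^ m * A ^ (j - m))
  have hT : ∀ j m, m ≤ j → (T j m).totalDegree ≤ j + m := by
    intro j m hm
    refine (MvPolynomial.totalDegree_mul _ _).trans ?_
    rw [MvPolynomial.totalDegree_C, zero_add]
    refine (MvPolynomial.totalDegree_mul _ _).trans ?_
    have h1 := (MvPolynomial.totalDegree_pow B m).trans (Nat.mul_le_mul_left m hB)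
    have h2 := (MvPolynomial.totalDegree_pow A (j - m)).trans (Nat.mul_le_mul_left (j - m) hA)
    omega
  have hev : ∀ x : EuclideanSpace ℝ (Fin n), MvPolynomial.eval (fun i => x i)
      (∑ j ∈ Finset.range N, ∑ m ∈ Finset.range (j + 1), if j + m < N then T j m else 0) =
      ‖y‖ ^ l * ∑ j ∈ Finset.range N, ∑ m ∈ Finset.range (j + 1),
        if j + m < N then c j * ((-(‖x‖ / ‖y‖) ^ 2) ^ m *
          (2 * inner ℝ x y / ‖y‖ ^ 2) ^ (j - m) * (j.choose m : ℝ)) else 0 := by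
    intro x
    have eA : MvPolynomial.eval (fun i => x i) A = 2 * inner ℝ x y / ‖y‖ ^ 2 := by
      simp only [A, map_sum, map_mul, MvPolynomial.eval_C, MvPolynomial.eval_X, PiLp.inner_apply,
        Finset.mul_sum, Finset.sum_div]
      refine Finset.sum_congr rfl fun i _ => ?_
      simp; ring
    have eB : MvPolynomial.eval (fun i => x i) B = -(‖x‖ / ‖y‖) ^ 2 := by
      simp only [B, map_sum, map_mul, MvPolynomial.eval_C, MvPolynomial.eval_X, map_pow]
      rw [← Finset.mul_sum, div_pow, EuclideanSpace.real_norm_sq_eq x]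
      ring
    rw [map_sum, Finset.mul_sum]
    refine Finset.sum_congr rfl fun j _ => ?_
    rw [map_sum, Finset.mul_sum]
    refine Finset.sum_congr rfl fun m _ => ?_
    split_ifs
    · simp only [T, map_mul, map_pow, MvPolynomial.eval_C, eA, eB]
      ring
    · simp
  have ha : ∀ x : EuclideanSpace ℝ (Fin n), |2 * inner ℝ x y / ‖y‖ ^ 2| ≤ 2 * (‖x‖ / ‖y‖) := by
    intro x
    rw [abs_div, abs_mul, abs_two, abs_of_pos (pow_pos hy0 2), div_le_iff₀ (by positivity)]
    have := abs_real_inner_le_norm x y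
    have e : 2 * (‖x‖ / ‖y‖) * ‖y‖ ^ 2 = 2 * (‖x‖ * ‖y‖) := by field_simp
    rw [e]; linarith
  refine ⟨∑ j ∈ Finset.range N, ∑ m ∈ Finset.range (j + 1), if j + m < N then T j m else 0,
    Submodule.sum_mem _ fun j hj => Submodule.sum_mem _ fun m hm => ?_, ?_, ?_⟩
  · split_ifs with h
    · rw [MvPolynomial.mem_restrictSupport_iff]
      intro α hα
      have h1 := (MvPolynomial.le_totalDegree hα).trans (hT j m (by simp at hm; omega))
      rw [Finsupp.sum_fintype _ _ (fun _ => rfl)] at h1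
      exact h1.trans_lt h
    · exact zero_mem _
  · intro x hx
    rw [hev]
    set r := ‖x‖ / ‖y‖ with hr
    set a := 2 * inner ℝ x y / ‖y‖ ^ 2
    have hr0 : 0 ≤ r := by positivity
    have hrd : r ≤ δ / 3 := by rw [hr, div_le_iff₀ hy0]; exact hx
    have h1 := (ht a (r ^ 2) r hr0 (ha x) (by rw [abs_of_nonneg (by positivity)])).1 (by linarith)
    have hw : |a - r ^ 2| ≤ 3 * r := by
      refine (abs_sub _ _).trans ?_
      rw [abs_of_nonneg (sq_nonneg r)]
      nlinarith [ha x]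
    have h2 := hc (a - r ^ 2) (by linarith)
    have hn : ‖x - y‖ ^ 2 = ‖y‖ ^ 2 * (1 - (a - r ^ 2)) := by
      rw [norm_sub_sq_real]
      simp only [a, r]
      field_simp
      ring
    have h0 : 0 ≤ 1 - (a - r ^ 2) := by
      have := le_abs_self (a - r ^ 2)
      linarith
    have hl : ‖x - y‖ ^ l = ‖y‖ ^ l * (1 - (a - r ^ 2)) ^ ((l : ℝ) / 2) := by
      have e : ∀ u : ℝ, 0 ≤ u → u ^ l = (u ^ 2) ^ ((l : ℝ) / 2) := by
        intro u hu
        rw [← Real.rpow_intCast, ← Real.rpow_natCast, ← Real.rpow_mul hu]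
        congr 1; push_cast; ring
      rw [e _ (norm_nonneg _), e _ (norm_nonneg y), hn, Real.mul_rpow (by positivity) h0]
    rw [hl, ← mul_sub, abs_mul, abs_of_pos (zpow_pos hy0 l), mul_left_comm]
    refine mul_le_mul_of_nonneg_left ?_ (zpow_pos hy0 l).le
    have h3 : |a - r ^ 2| ^ N ≤ 3 ^ N * r ^ N := by rw [← mul_pow]; gcongr
    have h4 : 0 ≤ M / (δ / 3) ^ N * r ^ N := by positivity
    have h5 : K * |a - r ^ 2| ^ N ≤ K * (3 ^ N * r ^ N) := by gcongr
    refine (abs_sub_le _ _ _).trans ((add_le_add h2 h1).trans ?_)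
    linarith
  · intro x hx
    rw [hev]
    set r := ‖x‖ / ‖y‖ with hr
    have hr0 : 0 ≤ r := by positivity
    have hrd : δ / 3 ≤ r := by rw [hr, le_div_iff₀ hy0]; exact hx
    have h1 := (ht (2 * inner ℝ x y / ‖y‖ ^ 2) (r ^ 2) r hr0 (ha x)
      (by rw [abs_of_nonneg (by positivity)])).2 _ hε hε1 hrd
    rw [abs_mul, abs_of_pos (zpow_pos hy0 l), mul_left_comm]
    refine mul_le_mul_of_nonneg_left ?_ (zpow_pos hy0 l).le
    rw [mul_comm, ← le_div_iff₀ (by positivity)] at h1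
    refine h1.trans ?_
    rw [add_mul, mul_div_right_comm]
    exact le_add_of_nonneg_left (by positivity)

lemma rpow_le_mul_rpow_of_le_mul {u v A e : ℝ} (hu : 0 < u) (hv : 0 < v) (hA : 0 < A)
    (h : u ≤ A * v) (he : e ≤ 0) : v ^ e ≤ A ^ (-e) * u ^ e := by
  have h1 := Real.rpow_le_rpow_of_nonpos hu h he
  rw [Real.mul_rpow hA.le hv.le] at h1
  calc v ^ e = A ^ (-e) * (A ^ e * v ^ e) := by
        rw [← mul_assoc, ← Real.rpow_add hA, neg_add_cancel, Real.rpow_zero, one_mul]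
    _ ≤ _ := by gcongr

lemma exists_weight_mul_norm_sub_zpow_le {E : Type*} [NormedAddCommGroup E] (θ σ A : ℝ) (l : ℤ)
    (hA : 0 < A) (hθ : l < 0 → (l : ℝ) ≤ θ) (hσ : 0 ≤ σ - θ + l) : ∃ M : ℝ, 0 ≤ M ∧ ∀ x y : E,
      japaneseBracket y ≤ A * japaneseBracket x →
      japaneseBracket x ^ (-σ) * ‖x - y‖ ^ l ≤ M * (japaneseBracket y ^ ((l : ℝ) - θ) *
        (japaneseBracket x ^ (max θ l - σ) +
          ‖x - y‖ ^ l * japaneseBracket (x - y) ^ (-(σ - θ) - l))) := by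
  rcases le_or_gt 0 l with hl | hl
  · lift l to ℕ using hl
    refine ⟨(1 + A) ^ l * (1 + A ^ (θ - l)), by positivity, fun x y h => ?_⟩
    have hx := japaneseBracket_pos x
    have hy := japaneseBracket_pos y
    have hz := japaneseBracket_pos (x - y)
    simp only [zpow_natCast, Int.cast_natCast]
    have h1 : ‖x - y‖ ^ l ≤ (1 + A) ^ l * japaneseBracket x ^ (l : ℝ) := by
      rw [Real.rpow_natCast, ← mul_pow]
      gcongr
      linarith [(norm_le_japaneseBracket (x - y)).trans (japaneseBracket_sub_le x y)]
    have h2 : japaneseBracket x ^ (l : ℝ) ≤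
        (1 + A ^ (θ - l)) * (japaneseBracket y ^ ((l : ℝ) - θ) * japaneseBracket x ^ max θ l) := by
      rcases le_total θ l with h' | h'
      · rw [max_eq_right h']
        have h3 : 1 ≤ japaneseBracket y ^ ((l : ℝ) - θ) :=
          Real.one_le_rpow (one_le_japaneseBracket y) (by linarith)
        have h4 : 0 ≤ A ^ (θ - l) := by positivity
        rw [← mul_assoc]
        exact le_mul_of_one_le_left (by positivity) (by nlinarith)
      · rw [max_eq_left h']
        have h3 := rpow_le_mul_rpow_of_le_mul hy hx hA h (e := (l : ℝ) - θ) (by linarith)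
        rw [neg_sub] at h3
        calc japaneseBracket x ^ (l : ℝ) = japaneseBracket x ^ ((l : ℝ) - θ) *
              japaneseBracket x ^ θ := by rw [← Real.rpow_add hx]; ring_nf
          _ ≤ (A ^ (θ - l) * japaneseBracket y ^ ((l : ℝ) - θ)) * japaneseBracket x ^ θ := by gcongr
          _ ≤ ((1 + A ^ (θ - l)) * japaneseBracket y ^ ((l : ℝ) - θ)) *
              japaneseBracket x ^ θ := by gcongr; linarith
          _ = _ := by ring
    calc japaneseBracket x ^ (-σ) * ‖x - y‖ ^ l
        ≤ japaneseBracket x ^ (-σ) * ((1 + A) ^ l * ((1 + A ^ (θ - l)) *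
          (japaneseBracket y ^ ((l : ℝ) - θ) * japaneseBracket x ^ max θ l))) := by
          gcongr; exact h1.trans (by gcongr)
      _ = (1 + A) ^ l * (1 + A ^ (θ - l)) * (japaneseBracket y ^ ((l : ℝ) - θ) *
          japaneseBracket x ^ (max θ l - σ)) := by
          rw [sub_eq_add_neg (max θ _), Real.rpow_add hx]; ring
      _ ≤ _ := by
          gcongr
          exact le_add_of_nonneg_right (by positivity)
  · refine ⟨A ^ (θ - l) * (1 + A) ^ (σ - θ + l), by positivity, fun x y h => ?_⟩
    have hx := japaneseBracket_pos x
    have hy := japaneseBracket_pos y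
    have hz := japaneseBracket_pos (x - y)
    have h1 := rpow_le_mul_rpow_of_le_mul hy hx hA h (e := (l : ℝ) - θ) (by linarith [hθ hl])
    have h2 := rpow_le_mul_rpow_of_le_mul hz hx (A := 1 + A) (by positivity)
      (by linarith [japaneseBracket_sub_le x y]) (e := -(σ - θ) - l) (by linarith)
    rw [neg_sub] at h1
    rw [show -(-(σ - θ) - (l : ℝ)) = σ - θ + l by ring] at h2
    calc japaneseBracket x ^ (-σ) * ‖x - y‖ ^ l
        = japaneseBracket x ^ ((l : ℝ) - θ) * japaneseBracket x ^ (-(σ - θ) - l) *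
          ‖x - y‖ ^ l := by rw [← Real.rpow_add hx]; ring_nf
      _ ≤ (A ^ (θ - l) * japaneseBracket y ^ ((l : ℝ) - θ)) *
          ((1 + A) ^ (σ - θ + l) * japaneseBracket (x - y) ^ (-(σ - θ) - l)) * ‖x - y‖ ^ l := by
          gcongr
      _ = A ^ (θ - l) * (1 + A) ^ (σ - θ + l) * (japaneseBracket y ^ ((l : ℝ) - θ) *
          (‖x - y‖ ^ l * japaneseBracket (x - y) ^ (-(σ - θ) - l))) := by ring
      _ ≤ _ := by
          gcongr
          exact le_add_of_nonneg_left (by positivity)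

lemma norm_zpow_mul_div_pow_le {E : Type*} [NormedAddCommGroup E] (N : ℕ) (l : ℤ) (m : ℝ)
    (hm : (N : ℝ) ≤ m) (x y : E) (hy : 1 ≤ ‖y‖) :
    ‖y‖ ^ l * (‖x‖ / ‖y‖) ^ N ≤ 2 ^ |(l : ℝ) - N| *
      (japaneseBracket y ^ ((l : ℝ) - N) * japaneseBracket x ^ m) := by
  have hy0 : 0 < ‖y‖ := one_pos.trans_le hy
  have hjy := japaneseBracket_pos y
  have hjx := japaneseBracket_pos x
  have h1 : ‖y‖ ^ ((l : ℝ) - N) ≤ 2 ^ |(l : ℝ) - N| * japaneseBracket y ^ ((l : ℝ) - N) := by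
    rcases le_total 0 ((l : ℝ) - N) with h | h
    · refine (Real.rpow_le_rpow hy0.le (norm_le_japaneseBracket y) h).trans ?_
      exact le_mul_of_one_le_left (by positivity)
        (Real.one_le_rpow one_le_two (abs_nonneg _))
    · rw [abs_of_nonpos h]
      exact rpow_le_mul_rpow_of_le_mul hjy hy0 two_pos
        (by linarith [japaneseBracket_le_one_add_norm y]) h
  have h2 : ‖x‖ ^ N ≤ japaneseBracket x ^ m := by
    calc ‖x‖ ^ N ≤ japaneseBracket x ^ N := by gcongr; exact norm_le_japaneseBracket x
      _ = japaneseBracket x ^ (N : ℝ) := (Real.rpow_natCast _ _).symm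
      _ ≤ _ := Real.rpow_le_rpow_of_exponent_le (one_le_japaneseBracket x) hm
  calc ‖y‖ ^ l * (‖x‖ / ‖y‖) ^ N = ‖y‖ ^ ((l : ℝ) - N) * ‖x‖ ^ N := by
        rw [Real.rpow_sub hy0, Real.rpow_intCast, Real.rpow_natCast, div_pow]; ring
    _ ≤ (2 ^ |(l : ℝ) - N| * japaneseBracket y ^ ((l : ℝ) - N)) * japaneseBracket x ^ m := by
        gcongr
    _ = _ := by ring

/-- Weighted pointwise bound on `‖x - y‖ ^ l` minus a polynomial of degree less than `N` in `x`, by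
a fixed function of `x` plus a translate of a fixed, locally square-integrable function. -/
lemma exists_polynomial_weighted_bound (n N : ℕ) (l : ℤ) (σ : ℝ) (hσ : 0 ≤ σ - N + l) :
    ∃ M : ℝ, 0 ≤ M ∧ ∀ y : EuclideanSpace ℝ (Fin n),
      ∃ P ∈ MvPolynomial.restrictSupport ℝ {α : Fin n →₀ ℕ | ∑ i, α i < N},
        ∀ x : EuclideanSpace ℝ (Fin n),
          japaneseBracket x ^ (-σ) * |‖x - y‖ ^ l - MvPolynomial.eval (fun i => x i) P| ≤
            M * (japaneseBracket y ^ ((l : ℝ) - N) * (japaneseBracket x ^ (max (N : ℝ) l - σ) +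
              ‖x - y‖ ^ l * japaneseBracket (x - y) ^ (-(σ - N) - l))) := by
  obtain ⟨ε, hε, hε1, K, hK, hP⟩ := exists_taylor_polynomial n N l
  obtain ⟨M, hM, hcr⟩ := exists_weight_mul_norm_sub_zpow_le (E := EuclideanSpace ℝ (Fin n))
    (N : ℝ) σ (2 / ε) l (by positivity)
    (fun h => (Int.cast_lt_zero.2 h).le.trans (Nat.cast_nonneg N)) hσ
  refine ⟨M + K * 2 ^ |(l : ℝ) - N|, by positivity, fun y => ?_⟩
  have h2ε : 2 ≤ 2 / ε := by rw [le_div_iff₀ hε]; linarith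
  have hjy := japaneseBracket_pos y
  have hsum : ∀ x : EuclideanSpace ℝ (Fin n), 0 ≤ japaneseBracket y ^ ((l : ℝ) - N) *
      (japaneseBracket x ^ (max (N : ℝ) l - σ) +
        ‖x - y‖ ^ l * japaneseBracket (x - y) ^ (-(σ - N) - l)) := fun x => by
    have := japaneseBracket_pos x
    have := japaneseBracket_pos (x - y)
    positivity
  rcases lt_or_ge ‖y‖ 1 with hy | hy
  · refine ⟨0, zero_mem _, fun x => ?_⟩
    rw [map_zero, sub_zero, abs_of_nonneg (by positivity), add_mul]
    have h := hcr x y (by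
      nlinarith [japaneseBracket_le_one_add_norm y, one_le_japaneseBracket x])
    exact h.trans (le_add_of_nonneg_right (mul_nonneg (by positivity) (hsum x)))
  · obtain ⟨P, hPs, hn, hf⟩ := hP y (norm_pos_iff.1 (one_pos.trans_le hy))
    refine ⟨P, hPs, fun x => ?_⟩
    have hjx := japaneseBracket_pos x
    have hjz := japaneseBracket_pos (x - y)
    have hpoly : japaneseBracket x ^ (-σ) * (K * (‖y‖ ^ l * (‖x‖ / ‖y‖) ^ N)) ≤
        K * 2 ^ |(l : ℝ) - N| * (japaneseBracket y ^ ((l : ℝ) - N) *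
          (japaneseBracket x ^ (max (N : ℝ) l - σ) +
            ‖x - y‖ ^ l * japaneseBracket (x - y) ^ (-(σ - N) - l))) := by
      calc _ ≤ japaneseBracket x ^ (-σ) * (K * (2 ^ |(l : ℝ) - N| *
            (japaneseBracket y ^ ((l : ℝ) - N) * japaneseBracket x ^ max (N : ℝ) l))) := by
            have h := norm_zpow_mul_div_pow_le N l _ (le_max_left (N : ℝ) l) x y hy
            exact mul_le_mul_of_nonneg_left (mul_le_mul_of_nonneg_left h hK) (by positivity)
        _ = K * 2 ^ |(l : ℝ) - N| * (japaneseBracket y ^ ((l : ℝ) - N) *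
            japaneseBracket x ^ (max (N : ℝ) l - σ)) := by
            rw [sub_eq_add_neg (max _ _), Real.rpow_add hjx]; ring
        _ ≤ _ := by
            gcongr
            exact le_add_of_nonneg_right (by positivity)
    rw [add_mul]
    rcases le_total ‖x‖ (ε * ‖y‖) with h | h
    · refine le_trans ?_ (hpoly.trans (le_add_of_nonneg_left (mul_nonneg hM (hsum x))))
      gcongr
      exact hn x h
    · have h3 : japaneseBracket y ≤ 2 / ε * japaneseBracket x := by
        rw [div_mul_eq_mul_div, le_div_iff₀ hε]
        nlinarith [japaneseBracket_le_one_add_norm y, norm_le_japaneseBracket x]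
      refine le_trans ?_ (add_le_add (hcr x y h3) hpoly)
      rw [← mul_add]
      gcongr
      refine (abs_sub _ _).trans (add_le_add ?_ (hf x h))
      rw [abs_of_nonneg (by positivity)]

lemma exists_Lp_polynomial_mul_eq {n N : ℕ} {σ C₀ : ℝ} (hσ : (N : ℝ) + n / 2 < σ)
    {v : EuclideanSpace ℝ (Fin n) → ℝ} (hv : Measurable v) (hv0 : ∀ x, 0 ≤ v x)
    (hvσ : ∀ x, v x ≤ C₀ * japaneseBracket x ^ (-σ))
    (Q : Lp ℂ 2 (volume : Measure (EuclideanSpace ℝ (Fin n))) →L[ℂ]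
            Lp ℂ 2 (volume : Measure (EuclideanSpace ℝ (Fin n))))
    (hQ : ∀ α : Fin n → ℕ, (∑ i, α i) < N →
      ∀ g : Lp ℂ 2 (volume : Measure (EuclideanSpace ℝ (Fin n))),
        (g : EuclideanSpace ℝ (Fin n) → ℂ) =ᵐ[volume]
          (fun x => (∏ i, ((x i : ℝ) : ℂ) ^ α i) * (v x : ℂ)) → Q g = 0)
    {P : MvPolynomial (Fin n) ℝ}
    (hP : P ∈ MvPolynomial.restrictSupport ℝ {α : Fin n →₀ ℕ | ∑ i, α i < N}) :
    ∃ p : Lp ℂ 2 (volume : Measure (EuclideanSpace ℝ (Fin n))),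
      (p : EuclideanSpace ℝ (Fin n) → ℂ) =ᵐ[volume]
        (fun x => ((MvPolynomial.eval (fun i => x i) P * v x : ℝ) : ℂ)) ∧ Q p = 0 := by
  have hmem : ∀ α : Fin n →₀ ℕ, ∑ i, α i < N →
      MemLp (fun x : EuclideanSpace ℝ (Fin n) => (∏ i, ((x i : ℝ) : ℂ) ^ α i) * (v x : ℂ)) 2
        volume := by
    intro α hα
    have h0 := (memLp_japaneseBracket (E := EuclideanSpace ℝ (Fin n)) (μ := volume) (s := σ - N)
      (by rw [finrank_euclideanSpace_fin]; linarith)).const_mul C₀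
    have hm : Measurable (fun x : EuclideanSpace ℝ (Fin n) =>
        (∏ i, ((x i : ℝ) : ℂ) ^ α i) * (v x : ℂ)) := by fun_prop
    refine h0.mono' hm.aestronglyMeasurable (Filter.Eventually.of_forall fun x => ?_)
    have hjx := japaneseBracket_pos x
    rw [norm_mul, norm_prod, Complex.norm_real, Real.norm_of_nonneg (hv0 x)]
    have h1 : ∏ i, ‖((x i : ℝ) : ℂ) ^ α i‖ ≤ japaneseBracket x ^ (N : ℝ) := by
      calc ∏ i, ‖((x i : ℝ) : ℂ) ^ α i‖ ≤ ∏ i, japaneseBracket x ^ α i := by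
            refine Finset.prod_le_prod (fun _ _ => norm_nonneg _) fun i _ => ?_
            rw [norm_pow, Complex.norm_real]
            gcongr
            exact (PiLp.norm_apply_le x i).trans (norm_le_japaneseBracket x)
        _ = japaneseBracket x ^ (∑ i, α i) := Finset.prod_pow_eq_pow_sum _ _ _
        _ ≤ japaneseBracket x ^ N := pow_le_pow_right₀ (one_le_japaneseBracket x) hα.le
        _ = _ := (Real.rpow_natCast _ _).symm
    calc _ ≤ japaneseBracket x ^ (N : ℝ) * (C₀ * japaneseBracket x ^ (-σ)) := by
          gcongr
          · exact hv0 x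
          · exact hvσ x
      _ = _ := by
          rw [neg_sub, sub_eq_add_neg, Real.rpow_add hjx]; ring
  have key : ∀ S : Finset (Fin n →₀ ℕ), (∀ α ∈ S, ∑ i, α i < N) →
      ∃ p : Lp ℂ 2 (volume : Measure (EuclideanSpace ℝ (Fin n))),
        (p : EuclideanSpace ℝ (Fin n) → ℂ) =ᵐ[volume] (fun x => ∑ α ∈ S,
          ((P.coeff α : ℝ) : ℂ) * ((∏ i, ((x i : ℝ) : ℂ) ^ α i) * (v x : ℂ))) ∧ Q p = 0 := by
    classical
    intro S
    induction S using Finset.induction_on with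
    | empty => exact fun _ => ⟨0, (Lp.coeFn_zero ℂ 2 volume).trans (by simp; rfl), map_zero Q⟩
    | insert α S hα ih =>
      intro h
      obtain ⟨p, hp, hQp⟩ := ih fun β hβ => h β (Finset.mem_insert_of_mem hβ)
      have hα' := h α (Finset.mem_insert_self _ _)
      refine ⟨((P.coeff α : ℝ) : ℂ) • (hmem α hα').toLp _ + p, ?_, ?_⟩
      · filter_upwards [Lp.coeFn_add (((P.coeff α : ℝ) : ℂ) • (hmem α hα').toLp _) p,
          Lp.coeFn_smul ((P.coeff α : ℝ) : ℂ) ((hmem α hα').toLp _), (hmem α hα').coeFn_toLp, hp]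
          with x h1 h2 h3 h4
        rw [h1, Pi.add_apply, h2, Pi.smul_apply, h3, h4, Finset.sum_insert hα, smul_eq_mul]
      · rw [map_add, map_smul, hQ α hα' _ (hmem α hα').coeFn_toLp, hQp, smul_zero, add_zero]
  obtain ⟨p, hp, hQp⟩ := key P.support fun α hα => hP hα
  refine ⟨p, hp.trans (Filter.Eventually.of_forall fun x => ?_), hQp⟩
  simp only [MvPolynomial.eval_eq', Finset.sum_mul]
  push_cast
  exact Finset.sum_congr rfl fun α _ => by ring

lemma norm_Lp_le_of_le_add_translate {G F : Type*} [AddGroup G] [MeasurableSpace G]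
    [MeasurableAdd G] {μ : Measure G} [μ.IsAddRightInvariant] [NormedAddCommGroup F]
    {h k : G → ℝ} (hh : MemLp h 2 μ) (hk : MemLp k 2 μ) {D : ℝ} (hD : 0 ≤ D) (y : G)
    (f : Lp F 2 μ) (hf : ∀ᵐ x ∂μ, ‖f x‖ ≤ D * (h x + k (x - y))) :
    ‖f‖ ≤ D * ((eLpNorm h 2 μ).toReal + (eLpNorm k 2 μ).toReal) := by
  have hτ := measurePreserving_sub_right μ y
  have h1 : eLpNorm (h + k ∘ fun x => x - y) 2 μ ≤ eLpNorm h 2 μ + eLpNorm k 2 μ :=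
    eLpNorm_comp_measurePreserving (p := 2) hk.1 hτ ▸
      eLpNorm_add_le hh.1 (hk.comp_measurePreserving hτ).1 one_le_two
  have hfin : eLpNorm h 2 μ + eLpNorm k 2 μ ≠ ∞ := ENNReal.add_ne_top.2 ⟨hh.2.ne, hk.2.ne⟩
  rw [← ENNReal.toReal_add hh.2.ne hk.2.ne, Lp.norm_def]
  calc _ ≤ (‖D‖ₑ * (eLpNorm h 2 μ + eLpNorm k 2 μ)).toReal := by
        refine ENNReal.toReal_mono (ENNReal.mul_ne_top enorm_ne_top hfin) ?_
        refine (eLpNorm_mono_ae_real (g := D • (h + k ∘ fun x => x - y)) hf).trans ?_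
        rw [eLpNorm_const_smul]
        gcongr
    _ = _ := by rw [ENNReal.toReal_mul, toReal_enorm, Real.norm_of_nonneg hD]

/-- If `Q` is an orthogonal projection on `L²(ℝⁿ)` annihilating `x^α v` for all
`|α| ≤ ϑ - 1`, where `0 ≤ v(x) ≤ C₀⟨x⟩^{-σ}` with `σ > max{ϑ, l} + n/2`, then
`‖Q(v(·)|· - y|^l)‖_{L²} ≤ C ⟨y⟩^{l-ϑ}`, with `C = C(n, ϑ, l, σ, C₀)`. -/
theorem projection_cancellation_estimate
    (n : ℕ) (hn : 1 ≤ n) (ϑ : ℕ) (l : ℤ) (hl : (1 : ℝ) - n ≤ 2 * (l : ℝ))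
    (σ C₀ : ℝ) (hσ : max (ϑ : ℝ) (l : ℝ) + n / 2 < σ) (hC₀ : 0 < C₀) :
    ∃ C : ℝ, 0 < C ∧
      ∀ v : EuclideanSpace ℝ (Fin n) → ℝ,
        Measurable v → (∀ x, 0 ≤ v x) →
        (∀ x, v x ≤ C₀ * Real.sqrt (1 + ‖x‖ ^ 2) ^ (-σ)) →
        ∀ Q : Lp ℂ 2 (volume : Measure (EuclideanSpace ℝ (Fin n))) →L[ℂ]
            Lp ℂ 2 (volume : Measure (EuclideanSpace ℝ (Fin n))),
          (∀ f, Q (Q f) = Q f) →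
          (∀ f g, ⟪Q f, g⟫ = ⟪f, Q g⟫) →
          (∀ α : Fin n → ℕ, (∑ i, α i) < ϑ →
            ∀ g : Lp ℂ 2 (volume : Measure (EuclideanSpace ℝ (Fin n))),
              (g : EuclideanSpace ℝ (Fin n) → ℂ) =ᵐ[volume]
                (fun x => (∏ i, ((x i : ℝ) : ℂ) ^ α i) * (v x : ℂ)) → Q g = 0) →
          ∀ y : EuclideanSpace ℝ (Fin n),
            ∀ g : Lp ℂ 2 (volume : Measure (EuclideanSpace ℝ (Fin n))),
              (g : EuclideanSpace ℝ (Fin n) → ℂ) =ᵐ[volume]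
                (fun x => ((v x : ℝ) : ℂ) * ((‖x - y‖ ^ l : ℝ) : ℂ)) →
              ‖Q g‖ ≤ C * Real.sqrt (1 + ‖y‖ ^ 2) ^ ((l : ℝ) - ϑ) := by
  have : Nontrivial (EuclideanSpace ℝ (Fin n)) :=
    Module.nontrivial_of_finrank_pos (R := ℝ) (by rw [finrank_euclideanSpace_fin]; exact hn)
  have hϑ : (ϑ : ℝ) + n / 2 < σ := by linarith [le_max_left (ϑ : ℝ) (l : ℝ)]
  obtain ⟨M, hM, hpt⟩ := exists_polynomial_weighted_bound n ϑ l σ (by linarith)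
  let h : EuclideanSpace ℝ (Fin n) → ℝ := fun x => japaneseBracket x ^ (max (ϑ : ℝ) l - σ)
  let k : EuclideanSpace ℝ (Fin n) → ℝ :=
    fun z => ‖z‖ ^ l * japaneseBracket z ^ (-(σ - ϑ) - l)
  have hh : MemLp h 2 volume := by
    have := memLp_japaneseBracket (E := EuclideanSpace ℝ (Fin n)) (μ := volume)
      (s := σ - max (ϑ : ℝ) l) (by rw [finrank_euclideanSpace_fin]; linarith)
    rwa [neg_sub] at this
  have hk : MemLp k 2 volume := memLp_norm_zpow_mul_japaneseBracket
    (by rw [finrank_euclideanSpace_fin]; linarith) (by rw [finrank_euclideanSpace_fin]; exact hl)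
  refine ⟨C₀ * M * ((eLpNorm h 2 volume).toReal + (eLpNorm k 2 volume).toReal) + 1,
    by positivity, fun v hv hv0 hvσ Q hQQ hQs hQ y g hg => ?_⟩
  change ‖Q g‖ ≤ _ * japaneseBracket y ^ ((l : ℝ) - ϑ)
  have hjy := japaneseBracket_pos y
  obtain ⟨P, hP, hPb⟩ := hpt y
  obtain ⟨p, hp, hQp⟩ := exists_Lp_polynomial_mul_eq hϑ hv hv0 hvσ Q hQ hP
  have hD : 0 ≤ C₀ * M * japaneseBracket y ^ ((l : ℝ) - ϑ) := by positivity
  have hbound : ∀ᵐ x ∂(volume : Measure (EuclideanSpace ℝ (Fin n))),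
      ‖(g - p : Lp ℂ 2 (volume : Measure (EuclideanSpace ℝ (Fin n)))) x‖ ≤
        C₀ * M * japaneseBracket y ^ ((l : ℝ) - ϑ) * (h x + k (x - y)) := by
    filter_upwards [Lp.coeFn_sub g p, hg, hp] with x h1 h2 h3
    have e : ((v x : ℝ) : ℂ) * ((‖x - y‖ ^ l : ℝ) : ℂ) -
        ((MvPolynomial.eval (fun i => x i) P * v x : ℝ) : ℂ) =
        ((v x * (‖x - y‖ ^ l - MvPolynomial.eval (fun i => x i) P) : ℝ) : ℂ) := by
      push_cast; ring
    rw [h1, Pi.sub_apply, h2, h3, e, Complex.norm_real, Real.norm_eq_abs, abs_mul,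
      abs_of_nonneg (hv0 x)]
    calc _ ≤ C₀ * japaneseBracket x ^ (-σ) *
          |‖x - y‖ ^ l - MvPolynomial.eval (fun i => x i) P| := by gcongr; exact hvσ x
      _ ≤ C₀ * (M * (japaneseBracket y ^ ((l : ℝ) - ϑ) * (h x + k (x - y)))) := by
          rw [mul_assoc]; exact mul_le_mul_of_nonneg_left (hPb x) hC₀.le
      _ = _ := by ring
  calc ‖Q g‖ = ‖Q (g - p)‖ := by rw [map_sub, hQp, sub_zero]
    _ ≤ ‖g - p‖ := norm_apply_le_of_orthogonal_projection Q hQQ hQs _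
    _ ≤ _ := norm_Lp_le_of_le_add_translate hh hk hD y _ hbound
    _ ≤ _ := by
      rw [add_mul, one_mul]
      have : 0 ≤ japaneseBracket y ^ ((l : ℝ) - ϑ) := by positivity
      linarith
end

section
/- Let m ≥ 2 be an integer and n odd with 1 ≤ n ≤ 2m−1. Let χ and φ₀ be as in the context, and let g ∈ C^{n+1}([λ₀/2, ∞); ℂ) satisfy |g^{(l)}(λ)| ≤ A λ^{−l} for all λ ≥ λ₀/2 and 0 ≤ l ≤ n+1, for some A > 0. Then there is a constant C, depending only on n, m, χ, φ₀ (and not on L, w, or g beyond A), such that for all L ≥ 1 and all w ∈ ℝ with w ≠ 0: |∫₀^∞ e^{iλw} λ^{n−2m} (1−χ(λ)) φ₀(λ/L) g(λ) dλ| ≤ C A min{1 + |log|w||, |w|^{−(n+1)}}. -/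
open MeasureTheory Set
open scoped ContDiff

/-- `f` behaves like a symbol of order `k` on `[a, ∞)`, up to `N` derivatives, with constant `K`. -/
structure IsSymbolOn {E : Type*} [NormedAddCommGroup E] [NormedSpace ℝ E]
    (a : ℝ) (k : ℤ) (N : ℕ) (K : ℝ) (f : ℝ → E) : Prop where
  contDiffOn : ContDiffOn ℝ N f (Ici a)
  bound : ∀ l ≤ N, ∀ x, a ≤ x → ‖iteratedDerivWithin l f (Ici a) x‖ ≤ K * x ^ (k - l)

section Symbol

variable {E : Type*} [NormedAddCommGroup E] [NormedSpace ℝ E]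

lemma norm_iteratedDerivWithin_smul_le {s : Set ℝ} {N l : ℕ} {f : ℝ → ℝ} {g : ℝ → E}
    (hf : ContDiffOn ℝ N f s) (hg : ContDiffOn ℝ N g s) (hs : UniqueDiffOn ℝ s)
    {x : ℝ} (hx : x ∈ s) (hl : l ≤ N) :
    ‖iteratedDerivWithin l (fun y => f y • g y) s x‖ ≤ ∑ i ∈ Finset.range (l + 1),
      (l.choose i : ℝ) * ‖iteratedDerivWithin i f s x‖ * ‖iteratedDerivWithin (l - i) g s x‖ := by
  have h := norm_iteratedFDerivWithin_smul_le hf hg hs hx (n := l) (by exact_mod_cast hl)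
  simpa only [norm_iteratedFDerivWithin_eq_norm_iteratedDerivWithin] using h

lemma IsSymbolOn.smul {a : ℝ} (ha : 0 < a) {k₁ k₂ : ℤ} {N : ℕ} {K₁ K₂ : ℝ} {f : ℝ → ℝ} {g : ℝ → E}
    (hf : IsSymbolOn a k₁ N K₁ f) (hg : IsSymbolOn a k₂ N K₂ g) (hK₁ : 0 ≤ K₁) (hK₂ : 0 ≤ K₂) :
    IsSymbolOn a (k₁ + k₂) N (2 ^ N * (K₁ * K₂)) (fun x => f x • g x) where
  contDiffOn := hf.contDiffOn.smul hg.contDiffOn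
  bound l hl x hx := by
    have hx0 : 0 < x := ha.trans_le hx
    refine (norm_iteratedDerivWithin_smul_le hf.contDiffOn hg.contDiffOn (uniqueDiffOn_Ici a)
      hx hl).trans ?_
    have hterm : ∀ i ∈ Finset.range (l + 1),
        (l.choose i : ℝ) * ‖iteratedDerivWithin i f (Ici a) x‖ *
          ‖iteratedDerivWithin (l - i) g (Ici a) x‖ ≤
        (l.choose i : ℝ) * (K₁ * K₂ * x ^ (k₁ + k₂ - l)) := by
      intro i hi
      have hil : i ≤ l := by simpa [Nat.lt_succ_iff] using hi
      rw [mul_assoc]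
      refine mul_le_mul_of_nonneg_left ?_ (Nat.cast_nonneg _)
      calc _ ≤ (K₁ * x ^ (k₁ - i)) * (K₂ * x ^ (k₂ - (l - i : ℕ))) := by
            refine mul_le_mul (hf.bound i (hil.trans hl) x hx)
              (hg.bound _ ((Nat.sub_le _ _).trans hl) x hx) (norm_nonneg _) (by positivity)
        _ = K₁ * K₂ * (x ^ (k₁ - i) * x ^ (k₂ - (l - i : ℕ))) := by ring
        _ = _ := by
            rw [← zpow_add₀ hx0.ne']
            congr 2
            push_cast [hil]
            ring
    refine (Finset.sum_le_sum hterm).trans ?_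
    rw [← Finset.sum_mul, ← Nat.cast_sum, Nat.sum_range_choose]
    have h2 : (2 : ℝ) ^ l ≤ 2 ^ N := pow_le_pow_right₀ (by norm_num) hl
    push_cast
    rw [mul_assoc (2 ^ N : ℝ)]
    exact mul_le_mul_of_nonneg_right h2 (by positivity)

lemma IsSymbolOn.weaken_order {a : ℝ} (ha : 0 < a) {k₁ k₂ : ℤ} (hk : k₁ ≤ k₂) {N : ℕ} {K : ℝ}
    (hK : 0 ≤ K) {f : ℝ → E} (hf : IsSymbolOn a k₁ N K f) :
    IsSymbolOn a k₂ N (K * a ^ (k₁ - k₂)) f where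
  contDiffOn := hf.contDiffOn
  bound l hl x hx := by
    have hx0 : 0 < x := ha.trans_le hx
    refine (hf.bound l hl x hx).trans ?_
    rw [mul_assoc]
    refine mul_le_mul_of_nonneg_left ?_ hK
    have h1 : x ^ (k₁ - l) = x ^ (k₁ - k₂) * x ^ (k₂ - l) := by
      rw [← zpow_add₀ hx0.ne']; congr 1; ring
    rw [h1]
    refine mul_le_mul_of_nonneg_right ?_ (by positivity)
    obtain ⟨p, hp⟩ : ∃ p : ℕ, k₁ - k₂ = -(p : ℤ) := ⟨(k₂ - k₁).toNat, by lia⟩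
    rw [hp, zpow_neg, zpow_neg, zpow_natCast, zpow_natCast]
    gcongr

lemma contDiffAt_zpow_of_ne_zero {x : ℝ} (hx : x ≠ 0) (k : ℤ) {N : ℕ∞ω} :
    ContDiffAt ℝ N (fun x : ℝ => x ^ k) x :=
  (analyticAt_id.zpow hx).contDiffAt

lemma exists_isSymbolOn_zpow {a : ℝ} (ha : 0 < a) (k : ℤ) (N : ℕ) :
    ∃ K, 0 ≤ K ∧ IsSymbolOn a k N K (fun x : ℝ => x ^ k) := by
  refine ⟨∑ l ∈ Finset.range (N + 1), ‖∏ i ∈ Finset.range l, ((k : ℝ) - i)‖,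
    by positivity, ?_, ?_⟩
  · intro x hx
    exact (contDiffAt_zpow_of_ne_zero (ha.trans_le hx).ne' k).contDiffWithinAt
  · intro l hl x hx
    have hx0 : 0 < x := ha.trans_le hx
    have hc : ContDiffAt ℝ l (fun x : ℝ => x ^ k) x := contDiffAt_zpow_of_ne_zero hx0.ne' k
    rw [iteratedDerivWithin_eq_iteratedDeriv (uniqueDiffOn_Ici a) hc hx, iteratedDeriv_eq_iterate,
      iter_deriv_zpow, norm_mul, norm_zpow, Real.norm_of_nonneg hx0.le]
    refine mul_le_mul_of_nonneg_right ?_ (by positivity)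
    exact Finset.single_le_sum (f := fun l => ‖∏ i ∈ Finset.range l, ((k : ℝ) - i)‖)
      (fun i _ => norm_nonneg _) (Finset.mem_range.2 (Nat.lt_succ_of_le hl))

lemma exists_pow_mul_norm_iteratedDeriv_le {h : ℝ → ℝ} {r : ℝ} (hh : ContDiff ℝ ∞ h)
    (h0 : ∀ t, r ≤ |t| → h t = 0) (N : ℕ) :
    ∃ M, 0 ≤ M ∧ ∀ l ≤ N, ∀ x, |x| ^ l * ‖iteratedDeriv l h x‖ ≤ M := by
  have hone : ∀ l : ℕ, ∃ M, 0 ≤ M ∧ ∀ x, |x| ^ l * ‖iteratedDeriv l h x‖ ≤ M := by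
    intro l
    have hcont : Continuous fun x => |x| ^ l * ‖iteratedDeriv l h x‖ := by
      have := hh.continuous_iteratedDeriv l (by exact_mod_cast le_top)
      fun_prop
    obtain ⟨M, hM⟩ := (isCompact_Icc (a := -r) (b := r)).bddAbove_image hcont.continuousOn
    refine ⟨max M 0, le_max_right _ _, fun x => ?_⟩
    by_cases hx : |x| ≤ r
    · exact (hM ⟨x, abs_le.1 hx, rfl⟩).trans (le_max_left _ _)
    · have hev : h =ᶠ[nhds x] fun _ => 0 := by
        filter_upwards [(isOpen_lt continuous_const continuous_abs).mem_nhds (not_le.1 hx)]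
          with y hy using h0 y (le_of_lt hy)
      rw [hev.iteratedDeriv_eq]
      simp
  choose M hM0 hM using hone
  refine ⟨∑ l ∈ Finset.range (N + 1), M l, Finset.sum_nonneg fun l _ => hM0 l, fun l hl x => ?_⟩
  exact (hM l x).trans (Finset.single_le_sum (f := M) (fun i _ => hM0 i)
    (Finset.mem_range.2 (Nat.lt_succ_of_le hl)))

lemma isSymbolOn_comp_div {a : ℝ} (ha : 0 < a) {h : ℝ → ℝ} (hh : ContDiff ℝ ∞ h) {N : ℕ} {M : ℝ}
    (hM : ∀ l ≤ N, ∀ x, |x| ^ l * ‖iteratedDeriv l h x‖ ≤ M) {L : ℝ} (hL : 0 < L) :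
    IsSymbolOn a 0 N M (fun x => h (x / L)) where
  contDiffOn := ((hh.of_le (by exact_mod_cast le_top)).comp
    (contDiff_id.div_const L)).contDiffOn
  bound l hl x hx := by
    have hx0 : 0 < x := ha.trans_le hx
    have hhl : ContDiff ℝ l h := hh.of_le (by exact_mod_cast le_top)
    have hc : ContDiff ℝ l (fun x => h (x / L)) := hhl.comp (contDiff_id.div_const L)
    have hfun : (fun x => h (x / L)) = fun x => h (L⁻¹ * x) := by
      ext y; rw [div_eq_inv_mul]
    rw [iteratedDerivWithin_eq_iteratedDeriv (uniqueDiffOn_Ici a) hc.contDiffAt hx, hfun,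
      iteratedDeriv_comp_const_mul hhl]
    have hb := hM l hl (L⁻¹ * x)
    rw [abs_of_pos (by positivity), mul_pow] at hb
    rw [zero_sub, zpow_neg, zpow_natCast, ← div_eq_mul_inv, le_div_iff₀ (by positivity), norm_mul,
      Real.norm_of_nonneg (by positivity)]
    linarith

end Symbol

lemma iteratedDeriv_eq_zero_of_eqOn_Icc {h : ℝ → ℝ} (hh : ContDiff ℝ ∞ h) {a : ℝ} (ha : 0 < a)
    (h0 : ∀ t, |t| ≤ a → h t = 0) (l : ℕ) : iteratedDeriv l h a = 0 := by
  have hcont : Continuous (iteratedDeriv l h) :=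
    hh.continuous_iteratedDeriv l (by exact_mod_cast le_top)
  have hIoo : EqOn (iteratedDeriv l h) (fun _ => 0) (Ioo 0 a) := by
    intro x hx
    have hev : h =ᶠ[nhds x] fun _ => 0 := by
      filter_upwards [isOpen_Ioo.mem_nhds hx] with y hy
      exact h0 y (by rw [abs_of_pos hy.1]; exact hy.2.le)
    rw [hev.iteratedDeriv_eq]
    simp
  refine hIoo.closure hcont continuous_const ?_
  rw [closure_Ioo ha.ne]
  exact ⟨ha.le, le_rfl⟩

lemma norm_cexp_I_mul_mul (x w : ℝ) : ‖Complex.exp (Complex.I * x * w)‖ = 1 := by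
  rw [show Complex.I * x * w = ((x * w : ℝ) : ℂ) * Complex.I by push_cast; ring]
  exact Complex.norm_exp_ofReal_mul_I _

lemma abs_mul_norm_integral_cexp_mul_le {u u' : ℝ → ℂ} {c b : ℝ} (hcb : c ≤ b)
    (hu : ContinuousOn u (Icc c b)) (hd : ∀ x ∈ Ioo c b, HasDerivAt u (u' x) x)
    (hu' : IntervalIntegrable u' volume c b) (w : ℝ) :
    |w| * ‖∫ x in c..b, Complex.exp (Complex.I * x * w) * u x‖ ≤
      ‖u c‖ + ‖u b‖ + ‖∫ x in c..b, Complex.exp (Complex.I * x * w) * u' x‖ := by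
  have hv : ∀ x : ℝ, HasDerivAt (fun x : ℝ => Complex.exp (Complex.I * x * w))
      (Complex.exp (Complex.I * x * w) * (Complex.I * w)) x := by
    intro x
    have h1 : HasDerivAt (fun x : ℝ => Complex.I * (x : ℂ) * w) (Complex.I * 1 * w) x :=
      ((Complex.ofRealCLM.hasDerivAt (x := x)).const_mul Complex.I).mul_const (w : ℂ)
    simpa using h1.cexp
  have hparts := intervalIntegral.integral_mul_deriv_eq_deriv_mul_of_hasDerivAt
    (a := c) (b := b) (u := u) (u' := u') (v := fun x : ℝ => Complex.exp (Complex.I * x * w))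
    (v' := fun x : ℝ => Complex.exp (Complex.I * x * w) * (Complex.I * w))
    (by rwa [uIcc_of_le hcb]) (by fun_prop)
    (by rwa [min_eq_left hcb, max_eq_right hcb]) (fun x _ => hv x) hu'
    (Continuous.intervalIntegrable (by fun_prop) _ _)
  have hl : ∫ x in c..b, u x * (Complex.exp (Complex.I * x * w) * (Complex.I * w)) =
      (Complex.I * w) * ∫ x in c..b, Complex.exp (Complex.I * x * w) * u x := by
    rw [← intervalIntegral.integral_const_mul]
    congr 1; ext x; ring
  have hr : ∫ x in c..b, u' x * Complex.exp (Complex.I * x * w) =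
      ∫ x in c..b, Complex.exp (Complex.I * x * w) * u' x := by
    congr 1; ext x; ring
  rw [hl, hr] at hparts
  have hn := congrArg norm hparts
  rw [norm_mul, norm_mul, Complex.norm_I, one_mul, Complex.norm_real, Real.norm_eq_abs] at hn
  rw [hn]
  refine (norm_sub_le _ _).trans (add_le_add ((norm_sub_le _ _).trans ?_) le_rfl)
  rw [norm_mul, norm_mul, norm_cexp_I_mul_mul, norm_cexp_I_mul_mul, mul_one, mul_one, add_comm]

lemma integral_zpow_neg_le {c b : ℝ} (hc : 0 < c) (hcb : c ≤ b) {p : ℕ} (hp : 1 ≤ p) :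
    ∫ x in c..b, x ^ (-1 - p : ℤ) ≤ c ^ (-p : ℤ) := by
  have h0 : (0 : ℝ) ∉ uIcc c b := by
    rw [uIcc_of_le hcb]
    exact fun h => absurd h.1 (not_le.2 hc)
  rw [integral_zpow (Or.inr ⟨by lia, h0⟩)]
  have e : (-1 - p + 1 : ℤ) = -p := by ring
  have hp' : (1 : ℝ) ≤ p := by exact_mod_cast hp
  have hb : 0 ≤ b ^ (-p : ℤ) := by have := hc.trans_le hcb; positivity
  have hc' : 0 ≤ c ^ (-p : ℤ) := by positivity
  rw [e]
  push_cast
  rw [show ((-1 : ℝ) - p + 1) = -p by ring, div_neg, ← neg_div, div_le_iff₀ (by linarith)]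
  nlinarith

namespace IsSymbolOn

variable {a K L : ℝ} {N : ℕ} {f : ℝ → ℂ}

lemma norm_integral_cexp_mul_iteratedDerivWithin_le {k : ℤ} (ha : 0 < a)
    (hf : IsSymbolOn a k N K f) {l : ℕ} (hl : l ≤ N) {c b : ℝ} (hac : a ≤ c) (hcb : c ≤ b) (w : ℝ) :
    ‖∫ x in c..b, Complex.exp (Complex.I * x * w) * iteratedDerivWithin l f (Ici a) x‖ ≤
      K * ∫ x in c..b, x ^ (k - l) := by
  rw [← intervalIntegral.integral_const_mul]
  refine intervalIntegral.norm_integral_le_of_norm_le hcb ?_ ?_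
  · refine Filter.Eventually.of_forall fun x hx => ?_
    rw [norm_mul, norm_cexp_I_mul_mul, one_mul]
    exact hf.bound l hl x (hac.trans hx.1.le)
  · refine (intervalIntegral.intervalIntegrable_zpow (Or.inr ?_)).const_mul K
    rw [uIcc_of_le hcb]
    exact fun h => absurd h.1 (not_le.2 (ha.trans_le hac))

lemma abs_mul_norm_integral_le {k : ℤ} (hf : IsSymbolOn a k N K f) {l : ℕ} (hl : l < N)
    {c b : ℝ} (hac : a ≤ c) (hcb : c ≤ b) (w : ℝ) :
    |w| * ‖∫ x in c..b, Complex.exp (Complex.I * x * w) * iteratedDerivWithin l f (Ici a) x‖ ≤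
      ‖iteratedDerivWithin l f (Ici a) c‖ + ‖iteratedDerivWithin l f (Ici a) b‖ +
      ‖∫ x in c..b, Complex.exp (Complex.I * x * w) *
        iteratedDerivWithin (l + 1) f (Ici a) x‖ := by
  have hsub : Icc c b ⊆ Ici a := fun x hx => hac.trans hx.1
  have hud := uniqueDiffOn_Ici a
  refine abs_mul_norm_integral_cexp_mul_le hcb
    ((hf.contDiffOn.continuousOn_iteratedDerivWithin (by exact_mod_cast hl.le) hud).mono hsub)
    (fun x hx => ?_) ?_ w
  · rw [iteratedDerivWithin_succ]
    have hax : a < x := hac.trans_lt hx.1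
    exact ((hf.contDiffOn.differentiableOn_iteratedDerivWithin (by exact_mod_cast hl) hud)
      x hax.le).hasDerivWithinAt.hasDerivAt (Ici_mem_nhds hax)
  · refine ContinuousOn.intervalIntegrable ?_
    rw [uIcc_of_le hcb]
    exact (hf.contDiffOn.continuousOn_iteratedDerivWithin (by exact_mod_cast hl) hud).mono hsub

lemma norm_integral_le_inv_pow {p : ℕ} (ha : 0 < a) (hK : 0 ≤ K)
    (hf : IsSymbolOn a (-1) (p + 1) K f) {b : ℝ} (hab : a ≤ b)
    (hfa : ∀ l ≤ p, iteratedDerivWithin l f (Ici a) a = 0)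
    (hfb : ∀ l ≤ p, iteratedDerivWithin l f (Ici a) b = 0) {w : ℝ} (hw : w ≠ 0) :
    ‖∫ x in a..b, Complex.exp (Complex.I * x * w) * f x‖ ≤
      K * a ^ (-(p + 1 : ℕ) : ℤ) * (|w| ^ (p + 1))⁻¹ := by
  have hw' : 0 < |w| := abs_pos.2 hw
  have hiter : ∀ l ≤ p + 1, |w| ^ l * ‖∫ x in a..b, Complex.exp (Complex.I * x * w) * f x‖ ≤
      ‖∫ x in a..b, Complex.exp (Complex.I * x * w) * iteratedDerivWithin l f (Ici a) x‖ := by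
    intro l
    induction l with
    | zero => intro _; simp
    | succ l ih =>
      intro hl
      have h := hf.abs_mul_norm_integral_le (l := l) (by lia) le_rfl hab w
      rw [hfa l (by lia), hfb l (by lia), norm_zero, zero_add, zero_add] at h
      calc _ = |w| * (|w| ^ l * ‖∫ x in a..b, Complex.exp (Complex.I * x * w) * f x‖) := by ring
        _ ≤ _ := (mul_le_mul_of_nonneg_left (ih (by lia)) hw'.le).trans h
  have h1 := (hiter (p + 1) le_rfl).trans
    (hf.norm_integral_cexp_mul_iteratedDerivWithin_le ha le_rfl le_rfl hab w)
  have h2 := h1.trans (mul_le_mul_of_nonneg_left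
    (integral_zpow_neg_le ha hab (p := p + 1) (by lia)) hK)
  rw [← div_eq_mul_inv, le_div_iff₀ (by positivity)]
  linarith

lemma norm_integral_le_log (ha : 0 < a) (hK : 0 ≤ K) (hf : IsSymbolOn a (-1) N K f) (hN : 1 ≤ N)
    {b w : ℝ} (hw : w ≠ 0) (hab : a ≤ b) (hwb : |w|⁻¹ ≤ b) (hfb : f b = 0) :
    ‖∫ x in a..b, Complex.exp (Complex.I * x * w) * f x‖ ≤
      K * (2 + 2 * |Real.log a|) * (1 + |Real.log (|w|)|) := by
  have hw' : 0 < |w| := abs_pos.2 hw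
  set c := max a |w|⁻¹ with hc
  have hac : a ≤ c := le_max_left _ _
  have hcb : c ≤ b := max_le hab hwb
  have hc0 : 0 < c := ha.trans_le hac
  have hcont : ContinuousOn (fun x : ℝ => Complex.exp (Complex.I * x * w) * f x) (Ici a) :=
    Continuous.continuousOn (by fun_prop) |>.mul hf.contDiffOn.continuousOn
  have hint : ∀ s t, a ≤ s → s ≤ t → IntervalIntegrable
      (fun x : ℝ => Complex.exp (Complex.I * x * w) * f x) volume s t := by
    intro s t hs hst
    refine ContinuousOn.intervalIntegrable (hcont.mono ?_)
    rw [uIcc_of_le hst]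
    exact fun x hx => hs.trans hx.1
  rw [← intervalIntegral.integral_add_adjacent_intervals (hint a c le_rfl hac) (hint c b hac hcb)]
  have hlow : ‖∫ x in a..c, Complex.exp (Complex.I * x * w) * f x‖ ≤
      K * (2 * |Real.log a| + |Real.log (|w|)|) := by
    have h := hf.norm_integral_cexp_mul_iteratedDerivWithin_le ha (Nat.zero_le N) le_rfl hac w
    simp only [iteratedDerivWithin_zero, Nat.cast_zero, sub_zero, zpow_neg_one] at h
    rw [integral_inv_of_pos ha hc0, Real.log_div hc0.ne' ha.ne'] at h
    refine h.trans (mul_le_mul_of_nonneg_left ?_ hK)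
    have hlogc : Real.log c ≤ |Real.log a| + |Real.log (|w|)| := by
      rcases max_choice a |w|⁻¹ with h' | h'
      · rw [hc, h']
        linarith [le_abs_self (Real.log a), abs_nonneg (Real.log |w|)]
      · rw [hc, h', Real.log_inv]
        linarith [neg_le_abs (Real.log |w|), abs_nonneg (Real.log a)]
    linarith [neg_le_abs (Real.log a)]
  have hhigh : ‖∫ x in c..b, Complex.exp (Complex.I * x * w) * f x‖ ≤ K * 2 := by
    have h := hf.abs_mul_norm_integral_le (l := 0) (by lia) hac hcb w
    have h1 := hf.norm_integral_cexp_mul_iteratedDerivWithin_le (l := 1) ha hN hac hcb w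
    have h2 := mul_le_mul_of_nonneg_left (integral_zpow_neg_le hc0 hcb (p := 1) le_rfl) hK
    have h3 := hf.bound 0 (Nat.zero_le N) c hac
    simp only [iteratedDerivWithin_zero, hfb, norm_zero, Nat.cast_zero, sub_zero, zero_add,
      Nat.cast_one, zpow_neg_one, add_zero] at h h1 h2 h3
    have h4 : c⁻¹ ≤ |w| := inv_le_of_inv_le₀ hw' (le_max_right _ _)
    have h5 : K * c⁻¹ ≤ K * |w| := mul_le_mul_of_nonneg_left h4 hK
    have h6 := h1.trans h2
    refine le_of_mul_le_mul_left ?_ hw'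
    linarith
  refine (norm_add_le _ _).trans ((add_le_add hlow hhigh).trans ?_)
  have h6 : 0 ≤ |Real.log a| := abs_nonneg _
  have h7 : 0 ≤ |Real.log (|w|)| := abs_nonneg _
  rw [← mul_add, mul_assoc]
  refine mul_le_mul_of_nonneg_left ?_ hK
  nlinarith [mul_nonneg h6 h7]

end IsSymbolOn

/-- High-energy oscillatory integral with symbol: if `|g^{(l)}(λ)| ≤ A λ^{-l}` on
`[λ₀/2, ∞)` for `0 ≤ l ≤ n+1`, then for odd `1 ≤ n ≤ 2m-1`,
`|∫₀^∞ e^{iλw} λ^{n-2m} (1-χ(λ)) φ₀(λ/L) g(λ) dλ|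
  ≤ C A min{1 + |log|w||, |w|^{-(n+1)}}`, uniformly in `L ≥ 1` and `w ≠ 0`. -/
theorem high_energy_oscillatory_with_symbol
    (m n : ℕ) (hm : 2 ≤ m) (hodd : Odd n) (hn1 : 1 ≤ n) (hn2 : n ≤ 2 * m - 1)
    (lam0 : ℝ) (hlam0 : 0 < lam0) (χ φ0 : ℝ → ℝ)
    (hχ : ∀ k : ℕ, ContDiff ℝ k χ)
    (hχ1 : ∀ t : ℝ, |t| ≤ lam0 / 2 → χ t = 1)
    (hχ0 : ∀ t : ℝ, lam0 ≤ |t| → χ t = 0)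
    (hφ : ∀ k : ℕ, ContDiff ℝ k φ0)
    (hφ1 : ∀ t : ℝ, |t| ≤ 1 / 2 → φ0 t = 1)
    (hφ0 : ∀ t : ℝ, 1 ≤ |t| → φ0 t = 0) :
    ∃ C : ℝ, 0 < C ∧
      ∀ (g : ℝ → ℂ) (A : ℝ), 0 < A →
        ContDiffOn ℝ (n + 1) g (Set.Ici (lam0 / 2)) →
        (∀ l : ℕ, l ≤ n + 1 → ∀ lam : ℝ, lam0 / 2 ≤ lam →
          ‖iteratedDerivWithin l g (Set.Ici (lam0 / 2)) lam‖ ≤ A * lam ^ (-(l : ℤ))) →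
        ∀ L : ℝ, 1 ≤ L → ∀ w : ℝ, w ≠ 0 →
          ‖∫ lam in Set.Ioi (0 : ℝ),
              Complex.exp (Complex.I * (lam : ℂ) * (w : ℂ)) *
                (((lam ^ ((n : ℤ) - 2 * (m : ℤ)) : ℝ)) : ℂ) *
                (((1 - χ lam) * φ0 (lam / L) : ℝ) : ℂ) * g lam‖ ≤
            C * A * min (1 + |Real.log (abs w)|) ((abs w) ^ (-((n : ℝ) + 1))) := by
  have hχs : ContDiff ℝ ∞ χ := contDiff_infty.2 hχ
  have hφs : ContDiff ℝ ∞ φ0 := contDiff_infty.2 hφ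
  set a := lam0 / 2 with ha_def
  have ha : 0 < a := by positivity
  obtain ⟨Mχ, hMχ0, hMχ⟩ := exists_pow_mul_norm_iteratedDeriv_le hχs hχ0 (n + 1)
  obtain ⟨Mφ, hMφ0, hMφ⟩ := exists_pow_mul_norm_iteratedDeriv_le hφs hφ0 (n + 1)
  obtain ⟨Kz, hKz0, hKz⟩ := exists_isSymbolOn_zpow ha ((n : ℤ) - 2 * (m : ℤ)) (n + 1)
  have hψs : ContDiff ℝ ∞ (fun x => 1 - χ x) := contDiff_const.sub hχs
  have hMψ : ∀ l ≤ n + 1, ∀ x, |x| ^ l * ‖iteratedDeriv l (fun x => 1 - χ x) x‖ ≤ 1 + Mχ := by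
    intro l hl x
    have h := hMχ l hl x
    rcases Nat.eq_zero_or_pos l with rfl | hpos
    · simp only [iteratedDeriv_zero, pow_zero, one_mul] at h ⊢
      refine (norm_sub_le _ _).trans ?_
      rw [norm_one]
      linarith
    · rw [iteratedDeriv_const_sub hpos, iteratedDeriv_neg, norm_neg]
      linarith
  have hψ : IsSymbolOn a 0 (n + 1) (1 + Mχ) (fun x => 1 - χ x) := by
    simpa using isSymbolOn_comp_div ha hψs hMψ one_pos
  have hψa : ∀ l : ℕ, iteratedDerivWithin l (fun x => 1 - χ x) (Ici a) a = 0 := by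
    intro l
    rw [iteratedDerivWithin_eq_iteratedDeriv (uniqueDiffOn_Ici a)
      (hψs.of_le (by exact_mod_cast le_top)).contDiffAt self_mem_Ici]
    exact iteratedDeriv_eq_zero_of_eqOn_Icc hψs ha (fun t ht => by rw [hχ1 t ht, sub_self]) l
  set D : ℝ := 2 ^ (n + 1) * ((1 + Mχ) * (2 ^ (n + 1) * (Mφ * (2 ^ (n + 1) * Kz)))) *
    a ^ ((n : ℤ) - 2 * (m : ℤ) - -1) with hD
  have hD0 : 0 ≤ D := by positivity
  set C₁ : ℝ := 2 + 2 * |Real.log a| with hC₁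
  set C₂ : ℝ := a ^ (-(n + 1 : ℕ) : ℤ) with hC₂
  have hC₁0 : 0 < C₁ := by positivity
  have hC₂0 : 0 < C₂ := by positivity
  refine ⟨(D + 1) * (C₁ + C₂), by positivity, ?_⟩
  intro g A hA hg hgb L hL w hw
  have hL0 : 0 < L := by linarith
  have hw' : 0 < |w| := abs_pos.2 hw
  have hgs : IsSymbolOn a 0 (n + 1) A g :=
    ⟨by exact_mod_cast hg, fun l hl x hx => by simpa using hgb l hl x hx⟩
  set rest : ℝ → ℂ := fun x => φ0 (x / L) • (x ^ ((n : ℤ) - 2 * (m : ℤ)) • g x) with hrest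
  set f : ℝ → ℂ := fun x => (1 - χ x) • rest x with hf
  have hrests := (isSymbolOn_comp_div ha hφs hMφ hL0).smul ha (hKz.smul ha hgs hKz0 hA.le)
    hMφ0 (by positivity)
  have hfs : IsSymbolOn a (-1) (n + 1) (D * A) f := by
    have h := (hψ.smul ha hrests (by positivity) (by positivity)).weaken_order ha
      (k₂ := -1) (by lia) (by positivity)
    convert h using 1
    rw [hD]
    simp only [zero_add, add_zero]
    ring
  have hDA : 0 ≤ D * A := by positivity
  have hfa : ∀ l ≤ n, iteratedDerivWithin l f (Ici a) a = 0 := by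
    intro l hl
    have h := norm_iteratedDerivWithin_smul_le hψ.contDiffOn hrests.contDiffOn (uniqueDiffOn_Ici a)
      self_mem_Ici (l := l) (by lia)
    simp only [hψa, norm_zero, mul_zero, zero_mul, Finset.sum_const_zero] at h
    exact norm_le_zero_iff.1 h
  have hfL : ∀ x, L ≤ x → f x = 0 := by
    intro x hx
    have : φ0 (x / L) = 0 := hφ0 _ (by
      rw [abs_of_pos (div_pos (hL0.trans_le hx) hL0), le_div_iff₀ hL0]; linarith)
    simp [hf, hrest, this]
  set b := a + L + |w|⁻¹ with hb
  have hwinv : 0 < |w|⁻¹ := by positivity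
  have hab : a ≤ b := by linarith
  have hLb : L < b := by linarith
  have hfb : ∀ l ≤ n, iteratedDerivWithin l f (Ici a) b = 0 := by
    intro l _
    have hev : f =ᶠ[nhdsWithin b (Ici a)] fun _ => 0 := by
      filter_upwards [mem_nhdsWithin_of_mem_nhds (Ioi_mem_nhds hLb)] with y hy
      exact hfL y (le_of_lt hy)
    rw [hev.iteratedDerivWithin_eq (hfL b hLb.le)]
    simp
  have hintegral : ∫ lam in Set.Ioi (0 : ℝ),
      Complex.exp (Complex.I * (lam : ℂ) * (w : ℂ)) *
        (((lam ^ ((n : ℤ) - 2 * (m : ℤ)) : ℝ)) : ℂ) *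
        (((1 - χ lam) * φ0 (lam / L) : ℝ) : ℂ) * g lam =
      ∫ x in a..b, Complex.exp (Complex.I * x * w) * f x := by
    have hint : ∀ x : ℝ, Complex.exp (Complex.I * (x : ℂ) * (w : ℂ)) *
        (((x ^ ((n : ℤ) - 2 * (m : ℤ)) : ℝ)) : ℂ) *
        (((1 - χ x) * φ0 (x / L) : ℝ) : ℂ) * g x =
        Complex.exp (Complex.I * x * w) * f x := by
      intro x
      simp only [hf, hrest, Complex.real_smul]
      push_cast
      ring
    simp only [hint]
    rw [intervalIntegral.integral_of_le hab]
    refine setIntegral_eq_of_subset_of_forall_sdiff_eq_zero measurableSet_Ioi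
      (fun x hx => ha.trans hx.1) ?_
    rintro x ⟨hx0, hx⟩
    have hx0' : 0 < x := hx0
    have hfx : f x = 0 := by
      by_cases hxa : x ≤ a
      · simp [hf, hχ1 x (by rwa [abs_of_pos hx0'])]
      · refine hfL x (hLb.le.trans ?_)
        by_contra hxb
        exact hx ⟨not_le.1 hxa, (not_le.1 hxb).le⟩
    rw [hfx, mul_zero]
  rw [hintegral]
  have hlog := hfs.norm_integral_le_log ha hDA (by lia) hw hab (by linarith) (hfL b hLb.le)
  have hpow := hfs.norm_integral_le_inv_pow ha hDA hab hfa hfb hw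
  have hrpow : |w| ^ (-((n : ℝ) + 1)) = (|w| ^ (n + 1))⁻¹ := by
    rw [Real.rpow_neg hw'.le]
    congr 1
    exact_mod_cast Real.rpow_natCast |w| (n + 1)
  have hAD : 0 ≤ A * C₁ ∧ 0 ≤ A * C₂ ∧ 0 ≤ D * A * C₁ ∧ 0 ≤ D * A * C₂ :=
    ⟨by positivity, by positivity, by positivity, by positivity⟩
  rw [hrpow, mul_min_of_nonneg _ _ (by positivity)]
  refine le_min (hlog.trans ?_) (hpow.trans ?_)
  · refine mul_le_mul_of_nonneg_right ?_ (by positivity)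
    linarith
  · refine mul_le_mul_of_nonneg_right ?_ (by positivity)
    linarith
end

section
/- For every integer n ≥ 1 there is a constant C = C(n) such that for all c ∈ ℝ: ∫₀^∞ min{1 + |log|ρ − c||, |ρ − c|^{−(n+1)}} ρ^{(n−1)/2} dρ ≤ C ⟨c⟩^{(n−1)/2}, and likewise ∫₀^∞ min{1 + |log(ρ + |c|)|, (ρ + |c|)^{−(n+1)}} ρ^{(n−1)/2} dρ ≤ C ⟨c⟩^{(n−1)/2}. -/
open MeasureTheory
open scoped ENNReal

/-- An integrable majorant on the positive half-line for `min (1 + |log t|) (t ^ (-(n + 1)))`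
weighted by `max 1 t ^ ((n - 1) / 2)`. -/
noncomputable def radialMajorant (t : ℝ) : ℝ :=
  if t ≤ 1 then 3 * t ^ (-(1 / 2) : ℝ) else t ^ (-2 : ℝ)

lemma integrable_radialMajorant_abs : Integrable fun x : ℝ => radialMajorant |x| := by
  have h₀ : IntegrableOn radialMajorant (Set.Ioc 0 1) := by
    have h : IntegrableOn (fun t : ℝ => 3 * t ^ (-(1 / 2) : ℝ)) (Set.Ioc 0 1) := by
      rw [← intervalIntegrable_iff_integrableOn_Ioc_of_le zero_le_one]
      exact (intervalIntegral.intervalIntegrable_rpow' (by norm_num)).const_mul 3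
    exact h.congr_fun (fun t ht => by simp [radialMajorant, ht.2]) measurableSet_Ioc
  have h₁ : IntegrableOn radialMajorant (Set.Ioi 1) := by
    have h : IntegrableOn (fun t : ℝ => t ^ (-2 : ℝ)) (Set.Ioi 1) :=
      integrableOn_Ioi_rpow_of_lt (by norm_num) one_pos
    exact h.congr_fun (fun t ht => by simp [radialMajorant, not_le.2 (Set.mem_Ioi.1 ht)])
      measurableSet_Ioi
  have h : IntegrableOn radialMajorant (Set.Ioi 0) := by
    rw [← Set.Ioc_union_Ioi_eq_Ioi zero_le_one]
    exact h₀.union h₁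
  have hpos : IntegrableOn (fun x : ℝ => radialMajorant |x|) (Set.Ioi 0) :=
    h.congr_fun (fun x hx => by simp only [abs_of_pos (Set.mem_Ioi.1 hx)]) measurableSet_Ioi
  have hneg : IntegrableOn (fun x : ℝ => radialMajorant |x|) (Set.Iic 0) := by
    rw [integrableOn_Iic_iff_integrableOn_Iio]
    simpa using (show IntegrableOn (fun x : ℝ => radialMajorant |x|) (Set.Ioi (-0)) by
      simpa using hpos).comp_neg_Iio
  rw [← integrableOn_univ, ← Set.Iic_union_Ioi (a := (0 : ℝ))]
  exact hneg.union hpos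

lemma one_add_abs_log_le {t : ℝ} (ht : 0 < t) (ht1 : t ≤ 1) :
    1 + |Real.log t| ≤ 3 * t ^ (-(1 / 2) : ℝ) := by
  have h₁ : 1 ≤ t ^ (-(1 / 2) : ℝ) :=
    Real.one_le_rpow_of_pos_of_le_one_of_nonpos ht ht1 (by norm_num)
  have h₂ := Real.log_le_rpow_div (inv_nonneg.2 ht.le) (show (0 : ℝ) < 1 / 2 by norm_num)
  rw [Real.log_inv, Real.inv_rpow ht.le, ← Real.rpow_neg ht.le] at h₂
  rw [abs_of_nonpos (Real.log_nonpos ht.le ht1)]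
  linarith

lemma min_log_rpow_mul_rpow_le {n : ℕ} (hn : 1 ≤ n) {t ρ B : ℝ} (ht : 0 ≤ t) (hρ : 0 ≤ ρ)
    (hB : 0 ≤ B) (h : ρ ≤ B * max 1 t) :
    min (1 + |Real.log t|) (t ^ (-((n : ℝ) + 1))) * ρ ^ (((n : ℝ) - 1) / 2) ≤
      B ^ (((n : ℝ) - 1) / 2) * radialMajorant t := by
  have hn' : (1 : ℝ) ≤ n := by exact_mod_cast hn
  have hk : 0 ≤ ((n : ℝ) - 1) / 2 := by linarith
  have hρk : ρ ^ (((n : ℝ) - 1) / 2) ≤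
      B ^ (((n : ℝ) - 1) / 2) * max 1 t ^ (((n : ℝ) - 1) / 2) := by
    rw [← Real.mul_rpow hB (by positivity)]
    exact Real.rpow_le_rpow hρ h hk
  have hm : 0 ≤ min (1 + |Real.log t|) (t ^ (-((n : ℝ) + 1))) :=
    le_min (by positivity) (by positivity)
  refine (mul_le_mul_of_nonneg_left hρk hm).trans ?_
  rw [mul_left_comm]
  refine mul_le_mul_of_nonneg_left ?_ (by positivity)
  rcases le_or_gt t 1 with ht1 | ht1
  · rw [max_eq_left ht1, Real.one_rpow, mul_one, radialMajorant, if_pos ht1]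
    rcases ht.eq_or_lt with rfl | ht0
    · refine (min_le_right _ _).trans ?_
      rw [Real.zero_rpow (by linarith)]
      positivity
    · exact (min_le_left _ _).trans (one_add_abs_log_le ht0 ht1)
  · rw [max_eq_right ht1.le, radialMajorant, if_neg ht1.not_ge]
    refine (mul_le_mul_of_nonneg_right (min_le_right _ _) (by positivity)).trans ?_
    rw [← Real.rpow_add (by linarith)]
    exact Real.rpow_le_rpow_of_exponent_le ht1.le (by linarith)

lemma lintegral_min_log_rpow_mul_rpow_le {n : ℕ} (hn : 1 ≤ n) {B a : ℝ} (hB : 0 ≤ B)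
    {τ : ℝ → ℝ} (hτ : ∀ ρ, 0 < ρ → τ ρ = |ρ - a|) (h : ∀ ρ, 0 < ρ → ρ ≤ B * max 1 (τ ρ)) :
    ∫⁻ ρ in Set.Ioi (0 : ℝ), ENNReal.ofReal
        (min (1 + |Real.log (τ ρ)|) (τ ρ ^ (-((n : ℝ) + 1))) * ρ ^ (((n : ℝ) - 1) / 2)) ≤
      ENNReal.ofReal (B ^ (((n : ℝ) - 1) / 2) * ∫ x : ℝ, radialMajorant |x|) := by
  have hpos : ∀ x : ℝ, 0 ≤ radialMajorant |x| := fun x => by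
    unfold radialMajorant
    split_ifs <;> positivity
  calc
    _ ≤ ∫⁻ ρ in Set.Ioi (0 : ℝ),
        ENNReal.ofReal (B ^ (((n : ℝ) - 1) / 2) * radialMajorant |ρ - a|) := by
      refine setLIntegral_mono' measurableSet_Ioi fun ρ hρ => ENNReal.ofReal_le_ofReal ?_
      have hb := h ρ hρ
      rw [hτ ρ hρ] at hb ⊢
      exact min_log_rpow_mul_rpow_le hn (abs_nonneg _) (le_of_lt hρ) hB hb
    _ ≤ ∫⁻ ρ, ENNReal.ofReal (B ^ (((n : ℝ) - 1) / 2) * radialMajorant |ρ - a|) :=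
      setLIntegral_le_lintegral _ _
    _ = ∫⁻ x, ENNReal.ofReal (B ^ (((n : ℝ) - 1) / 2) * radialMajorant |x|) :=
      lintegral_sub_right_eq_self
        (fun x => ENNReal.ofReal (B ^ (((n : ℝ) - 1) / 2) * radialMajorant |x|)) a
    _ = _ := by
      rw [← integral_const_mul, ofReal_integral_eq_lintegral_ofReal
        (integrable_radialMajorant_abs.const_mul _)
        (Filter.Eventually.of_forall fun x => mul_nonneg (by positivity) (hpos x))]

/-- Elementary radial integral estimate:
`∫₀^∞ min{1 + |log|ρ-c||, |ρ-c|^{-(n+1)}} ρ^{(n-1)/2} dρ ≤ C ⟨c⟩^{(n-1)/2}`,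
and likewise with `ρ + |c|` in place of `|ρ - c|`. -/
theorem radial_log_integral_estimate (n : ℕ) (hn : 1 ≤ n) :
    ∃ C : ℝ, 0 < C ∧ ∀ c : ℝ,
      (∫⁻ ρ in Set.Ioi (0 : ℝ),
          ENNReal.ofReal
            (min (1 + |Real.log (abs (ρ - c))|) ((abs (ρ - c)) ^ (-((n : ℝ) + 1))) *
              ρ ^ (((n : ℝ) - 1) / 2)) ≤
        ENNReal.ofReal (C * Real.sqrt (1 + c ^ 2) ^ (((n : ℝ) - 1) / 2))) ∧
      (∫⁻ ρ in Set.Ioi (0 : ℝ),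
          ENNReal.ofReal
            (min (1 + |Real.log (ρ + abs c)|) ((ρ + abs c) ^ (-((n : ℝ) + 1))) *
              ρ ^ (((n : ℝ) - 1) / 2)) ≤
        ENNReal.ofReal (C * Real.sqrt (1 + c ^ 2) ^ (((n : ℝ) - 1) / 2))) := by
  set I : ℝ := ∫ x : ℝ, radialMajorant |x|
  set k : ℝ := ((n : ℝ) - 1) / 2
  refine ⟨2 ^ k * |I| + 1, by positivity, fun c => ?_⟩
  set s : ℝ := Real.sqrt (1 + c ^ 2)
  have hs1 : 1 ≤ s := Real.one_le_sqrt.2 (by nlinarith [sq_nonneg c])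
  have hsc : |c| ≤ s := Real.abs_le_sqrt (by linarith)
  have hbound : ENNReal.ofReal ((2 * s) ^ k * I) ≤
      ENNReal.ofReal ((2 ^ k * |I| + 1) * s ^ k) := by
    refine ENNReal.ofReal_le_ofReal ?_
    rw [Real.mul_rpow (by norm_num) (by linarith)]
    have h₁ : 0 ≤ s ^ k := by positivity
    have h₂ : 2 ^ k * s ^ k * I ≤ 2 ^ k * s ^ k * |I| :=
      mul_le_mul_of_nonneg_left (le_abs_self I) (by positivity)
    linarith
  constructor
  · refine (lintegral_min_log_rpow_mul_rpow_le hn (B := 2 * s) (a := c) (by positivity)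
      (τ := fun ρ => |ρ - c|) (fun _ _ => rfl) fun ρ _ => ?_).trans hbound
    have h₁ : ρ ≤ |ρ - c| + |c| := by linarith [le_abs_self (ρ - c), le_abs_self c]
    nlinarith [le_max_left 1 |ρ - c|, le_max_right 1 |ρ - c|]
  · refine (lintegral_min_log_rpow_mul_rpow_le hn (B := 2 * s) (a := -|c|) (by positivity)
      (τ := fun ρ => ρ + |c|) (fun ρ hρ => ?_) fun ρ hρ => ?_).trans hbound
    · rw [sub_neg_eq_add, abs_of_nonneg (add_nonneg hρ.le (abs_nonneg c))]
    · nlinarith [le_max_left 1 (ρ + |c|), le_max_right 1 (ρ + |c|), abs_nonneg c]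
end

section
/- Let n ≥ 5 be odd and let l be an odd integer with 1 ≤ l ≤ n−4. Then Σ_{j=0}^{min{l, (n−3)/2}} (−2)^j (n−3−j)! / ( j! · ((n−3)/2 − j)! · (l−j)! ) = 0. -/
open Polynomial in
/-- The odd coefficients of `(X ^ 2 - 1) ^ m = (1 + X) ^ m * ((1 + X) - 2) ^ m` vanish. -/
theorem sum_neg_two_pow_mul_choose_mul_choose_eq_zero (m k : ℕ) (hk : Odd k) :
    ∑ j ∈ Finset.range (m + 1),
      (-2 : ℚ) ^ j * (m.choose j : ℚ) * ((2 * m - j).choose k : ℚ) = 0 := by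
  have hexpand : ∑ j ∈ Finset.range (m + 1),
      C ((-2 : ℚ) ^ j * (m.choose j : ℚ)) * (1 + X) ^ (2 * m - j)
        = expand ℚ 2 ((X - 1) ^ m) := by
    have hfactor : expand ℚ 2 ((X - 1) ^ m) = (1 + X) ^ m * (C (-2) + (1 + X)) ^ m := by
      rw [← mul_pow]
      simp only [map_pow, map_sub, expand_X, map_one, map_neg, map_ofNat]
      congr 1
      ring
    rw [hfactor, add_pow (C (-2)), Finset.mul_sum]
    refine Finset.sum_congr rfl fun j hj => ?_
    have hjm : j ≤ m := Nat.lt_succ_iff.mp (Finset.mem_range.mp hj)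
    rw [show 2 * m - j = m + (m - j) by omega, pow_add]
    simp only [map_mul, map_pow, map_natCast]
    ring
  have hcoeff := congrArg (fun p => coeff p k) hexpand
  simp only [finsetSum_coeff, coeff_C_mul, coeff_one_add_X_pow] at hcoeff
  rw [hcoeff, coeff_expand two_pos, if_neg]
  exact fun h => (Nat.not_even_iff_odd.mpr hk) (even_iff_two_dvd.mpr h)

/-- Combinatorial cancellation: for odd `n ≥ 5` and odd `1 ≤ l ≤ n - 4`,
`Σ_{j=0}^{min{l,(n-3)/2}} (-2)^j (n-3-j)! / (j! ((n-3)/2 - j)! (l-j)!) = 0`. -/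
theorem odd_coefficient_cancellation
    (n l : ℕ) (hn : 5 ≤ n) (hnodd : Odd n) (hlodd : Odd l) (hl1 : 1 ≤ l)
    (hl2 : l ≤ n - 4) :
    ∑ j ∈ Finset.range (min l ((n - 3) / 2) + 1),
      ((-2 : ℚ)) ^ j * (Nat.factorial (n - 3 - j)) /
        ((Nat.factorial j) * (Nat.factorial ((n - 3) / 2 - j)) *
          (Nat.factorial (l - j))) = 0 := by
  obtain ⟨m, rfl⟩ : ∃ m, n = 2 * m + 3 := by
    obtain ⟨t, rfl⟩ := hnodd
    exact ⟨t - 1, by omega⟩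
  have hk : Odd (2 * m - l) := Nat.Even.sub_odd (by omega) (even_two_mul m) hlodd
  have hsum := sum_neg_two_pow_mul_choose_mul_choose_eq_zero m (2 * m - l) hk
  rw [show (2 * m + 3 - 3) / 2 = m by omega, show 2 * m + 3 - 3 = 2 * m by omega]
  rw [← Finset.sum_subset (s₁ := Finset.range (min l m + 1))] at hsum
  · rw [← mul_zero (((2 * m - l).factorial : ℚ) / m.factorial), ← hsum, Finset.mul_sum]
    refine Finset.sum_congr rfl fun j hj => ?_
    rw [Finset.mem_range] at hj
    rw [Nat.cast_choose ℚ (show j ≤ m by omega),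
      Nat.cast_choose ℚ (show 2 * m - l ≤ 2 * m - j by omega),
      show 2 * m - j - (2 * m - l) = l - j by omega]
    field_simp
  · intro j hj
    rw [Finset.mem_range] at hj ⊢
    omega
  · intro j hj hj'
    rw [Finset.mem_range] at hj hj'
    rw [Nat.choose_eq_zero_of_lt (show 2 * m - j < 2 * m - l by omega)]
    simp
end
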